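/- arXiv:1202.3066 — 7 statements merged into one kernel-verified Lean document; each statement's English description precedes it below -/
import Mathlib

section
/- Assume r ≥ 2. Let t be a positive integer with 2t < 3d, and let f be a nonzero homogeneous polynomial of degree d in x_0,…,x_r over K with sr(f) = t, admitting two non-identified decompositions. Then for every A ∈ S(f) there exists a nonzero homogeneous polynomial q of degree at most 2 in r+1 variables such that infinitely many pairwise non-identified decompositions B ∈ S(f) satisfy: every point of A not lying on Z(q) is a point of B, and every point of B that is not a point of A lies on Z(q). -/
open MvPolynomial

/-- The degree-`d` power of (a representative linear form of) a point of `ℙ^r`,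
regarded as a homogeneous polynomial of degree `d` in `x_0, …, x_r`. -/
noncomputable def powForm (K : Type) [Field K] (r d : ℕ)
    (p : Projectivization K (Fin (r + 1) → K)) : MvPolynomial (Fin (r + 1)) K :=
  (∑ i, MvPolynomial.C (p.rep i) * MvPolynomial.X i) ^ d

/-- The span of the `d`-th powers of the linear forms corresponding to a set of
points of `ℙ^r`. -/
noncomputable def decompSpan (K : Type) [Field K] (r d : ℕ)
    (S : Set (Projectivization K (Fin (r + 1) → K))) :
    Submodule K (MvPolynomial (Fin (r + 1)) K) :=
  Submodule.span K (powForm K r d '' S)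

/-- The symmetric rank of `f`. -/
noncomputable def symRank (K : Type) [Field K] (r d : ℕ)
    (f : MvPolynomial (Fin (r + 1)) K) : ℕ :=
  sInf {n | ∃ A : Finset (Projectivization K (Fin (r + 1) → K)),
    A.card = n ∧ f ∈ decompSpan K r d ↑A}

/-- `S(f)`: the set of decompositions of `f`, i.e. finite sets of points of `ℙ^r`
computing the symmetric rank of `f`. -/
def decompSet (K : Type) [Field K] (r d : ℕ) (f : MvPolynomial (Fin (r + 1)) K) :
    Set (Finset (Projectivization K (Fin (r + 1) → K))) :=
  {A | f ∈ decompSpan K r d ↑A ∧ A.card = symRank K r d f}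

/-- The points of `ℙ^r` lying on the hypersurface `Z(q)`. -/
def projZeros (K : Type) [Field K] (r : ℕ) (q : MvPolynomial (Fin (r + 1)) K) :
    Set (Projectivization K (Fin (r + 1) → K)) :=
  {p | MvPolynomial.eval p.rep q = 0}

/-- A line of `ℙ^r`. -/
def IsProjLine (K : Type) [Field K] (r : ℕ)
    (L : Set (Projectivization K (Fin (r + 1) → K))) : Prop :=
  ∃ W : Submodule K (Fin (r + 1) → K), Module.finrank K W = 2 ∧
    L = {p | p.rep ∈ W}

/-- A smooth conic of `ℙ^r`. -/
def IsSmoothConic (K : Type) [Field K] (r : ℕ)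
    (C : Set (Projectivization K (Fin (r + 1) → K))) : Prop :=
  ∃ u v w : Fin (r + 1) → K, LinearIndependent K ![u, v, w] ∧
    C = {p | ∃ s t : K, (s ≠ 0 ∨ t ≠ 0) ∧
      p.submodule = Submodule.span K {s ^ 2 • u + (s * t) • v + t ^ 2 • w}}

/-- Polynomials in more variables than there are equations, over an algebraically closed field,
have infinitely many common zeros as soon as they vanish at one suitable point. -/
lemma exists_point_infinite_zeros (K : Type*) [Field K] [IsAlgClosed K] (σ J : Type*)
    [Finite σ] [Fintype J] (hcard : Fintype.card J < Nat.card σ) :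
    ∃ y : σ → K, ∀ g : J → MvPolynomial σ K, (∀ j, eval y (g j) = 0) →
      {x : σ → K | ∀ j, eval x (g j) = 0}.Infinite := by
  have hdim : ringKrullDim (MvPolynomial σ K) = Nat.card σ := by
    simp [MvPolynomial.ringKrullDim_of_isNoetherianRing]
  have hnot : ¬ ringKrullDim (MvPolynomial σ K) ≤ ((Fintype.card J : ℕ) : WithBot ℕ∞) := by
    rw [hdim]
    intro h
    have : Nat.card σ ≤ Fintype.card J := by exact_mod_cast h
    omega
  rw [ringKrullDim_le_iff_isMaximal_height_le] at hnot
  push Not at hnot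
  obtain ⟨m, hm, hlt⟩ := hnot
  obtain ⟨y, rfl⟩ := MvPolynomial.isMaximal_iff_eq_vanishingIdeal_singleton.1 hm
  refine ⟨y, fun g hg hfin => ?_⟩
  set I : Ideal (MvPolynomial σ K) := Ideal.span (Set.range g) with hI
  have hIm : I ≤ vanishingIdeal K {y} := by
    rw [hI, Ideal.span_le]
    rintro _ ⟨j, rfl⟩
    simpa [mem_vanishingIdeal_singleton_iff] using hg j
  obtain ⟨p, hp, hpm⟩ := Ideal.exists_minimalPrimes_le hIm
  have hprime : p.IsPrime := hp.1.1
  have hzero : zeroLocus K p ⊆ {x : σ → K | ∀ j, eval x (g j) = 0} := by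
    intro x hx j
    have := hx (g j) (hp.1.2 (Ideal.subset_span ⟨j, rfl⟩))
    simpa using this
  have hzfin : (zeroLocus K p).Finite := hfin.subset hzero
  have hpmax : ∃ z ∈ zeroLocus K p, vanishingIdeal K {z} ≤ p := by
    have hinf : hzfin.toFinset.inf (fun z => vanishingIdeal K {z}) ≤ p := by
      conv_rhs => rw [← IsPrime.vanishingIdeal_zeroLocus (K := K) p]
      intro q hq
      rw [mem_vanishingIdeal_iff]
      intro z hz
      have := (Finset.inf_le (f := fun z => vanishingIdeal K {z})
        (hzfin.mem_toFinset.2 hz)) hq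
      simpa [mem_vanishingIdeal_singleton_iff] using this
    obtain ⟨z, hz, h⟩ := (Ideal.IsPrime.inf_le' hprime).1 hinf
    exact ⟨z, hzfin.mem_toFinset.1 hz, h⟩
  obtain ⟨z, hz, hzp⟩ := hpmax
  have hzm : (vanishingIdeal K {z} : Ideal (MvPolynomial σ K)).IsMaximal :=
    isMaximal_iff_eq_vanishingIdeal_singleton.2 ⟨z, rfl⟩
  have h1 := hzm.eq_of_le hprime.ne_top hzp
  have h2 := hzm.eq_of_le hm.ne_top (hzp.trans hpm)
  rw [← h2, h1] at hlt
  have := Ideal.height_le_card_of_mem_minimalPrimes_span (Set.finite_range g) hp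
  have h3 : (Set.range g).ncard ≤ Fintype.card J := by
    rw [← Set.image_univ, ← Nat.card_eq_fintype_card, ← Set.ncard_univ]
    exact Set.ncard_image_le
  have h4 : p.height ≤ (Fintype.card J : ℕ∞) := this.trans (by exact_mod_cast h3)
  exact absurd (WithBot.coe_le_coe.2 h4) (not_le.2 (by exact_mod_cast hlt))

lemma infinite_zeros {K σ J : Type*} [Field K] [IsAlgClosed K]
    [Finite σ] [Fintype J] (hcard : Fintype.card J < Nat.card σ) (g : J → MvPolynomial σ K)
    (x₀ : σ → K) (h₀ : ∀ j, eval x₀ (g j) = 0) :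
    {x : σ → K | ∀ j, eval x (g j) = 0}.Infinite := by
  obtain ⟨y, hy⟩ := exists_point_infinite_zeros K σ J hcard
  let τ : MvPolynomial σ K →ₐ[K] MvPolynomial σ K := aeval fun i => X i + C (x₀ i - y i)
  have hτ : ∀ x p, eval x (τ p) = eval (fun i => x i + (x₀ i - y i)) p := by
    intro x p
    have h : (aeval x : MvPolynomial σ K →ₐ[K] K).comp τ = aeval fun i => x i + (x₀ i - y i) := by
      ext i
      simp [τ]
    simpa [MvPolynomial.coe_aeval_eq_eval] using DFunLike.congr_fun h p
  have hinf := hy (fun j => τ (g j)) fun j => by simpa [hτ] using h₀ j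
  simp only [hτ] at hinf
  have hinj : Set.InjOn (fun (x : σ → K) i => x i + (x₀ i - y i))
      {x : σ → K | ∀ j, eval (fun i => x i + (x₀ i - y i)) (g j) = 0} := by
    intro a _ b _ hab
    funext i
    simpa using congrFun hab i
  refine (hinf.image hinj).mono ?_
  rintro _ ⟨x, hx, rfl⟩
  exact hx

lemma finrank_homogeneousSubmodule_three (K : Type*) [Field K] (n : ℕ) :
    Module.finrank K (homogeneousSubmodule (Fin 3) K n) = (n + 2).choose 2 := by
  have h : homogeneousSubmodule (Fin 3) K n =
      restrictSupport K {d : Fin 3 →₀ ℕ | d.degree = n} := by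
    rw [homogeneousSubmodule_eq_finsupp_supported]
    rfl
  rw [h, Module.finrank_eq_nat_card_basis (basisRestrictSupport K _)]
  have h2 : {d : Fin 3 →₀ ℕ | d.degree = n} =
      ((Finset.univ : Finset (Fin 3)).finsuppAntidiag n : Set (Fin 3 →₀ ℕ)) := by
    ext d
    simp [Finset.mem_finsuppAntidiag, Finsupp.degree_eq_sum]
  rw [h2, Nat.card_coe_set_eq, Set.ncard_coe_finset,
    Finset.card_finsuppAntidiag_nat_eq_choose, Finset.card_univ, Fintype.card_fin,
    show 3 + n - 1 = n + 2 by omega]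
  exact (Nat.choose_symm_add (a := n) (b := 2))

/-- Modulo multiples of a nonzero form `q` of degree `e ∈ {1, 2}`, the ternary forms of degree `d`
are spanned by `e * d + 1` of them. -/
lemma exists_forms_modulo {K : Type*} [Field K] {q : MvPolynomial (Fin 3) K} (hq : q ≠ 0) {e : ℕ}
    (he : e = 1 ∨ e = 2) (hqe : q.IsHomogeneous e) {d : ℕ} (hd : 1 ≤ d) :
    ∃ g : Fin (e * d + 1) → MvPolynomial (Fin 3) K, ∀ F : MvPolynomial (Fin 3) K,
      F.IsHomogeneous d → ∃ (b : Fin (e * d + 1) → K) (G : MvPolynomial (Fin 3) K),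
        F = ∑ j, b j • g j + q * G := by
  have : Module.Finite K (homogeneousSubmodule (Fin 3) K d) :=
    Module.Finite.iff_fg.2 (homogeneousSubmodule_fg (Fin 3) K d)
  rcases lt_or_ge d e with hlt | hle
  · obtain rfl : e = 2 := by omega
    obtain rfl : d = 1 := by omega
    let B := Module.finBasisOfFinrankEq K (homogeneousSubmodule (Fin 3) K 1) (n := 2 * 1 + 1)
      (by rw [finrank_homogeneousSubmodule_three]; rfl)
    refine ⟨fun j => (B j : MvPolynomial (Fin 3) K), fun F hF => ?_⟩
    refine ⟨fun j => B.repr ⟨F, hF⟩ j, 0, ?_⟩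
    have := congrArg (Submodule.subtype _) (B.sum_repr ⟨F, hF⟩)
    rw [map_sum] at this
    simp only [map_smul, Submodule.subtype_apply] at this
    rw [this, mul_zero, add_zero]
  · let S := homogeneousSubmodule (Fin 3) K d
    let φ : homogeneousSubmodule (Fin 3) K (d - e) →ₗ[K] S :=
      ((LinearMap.mulLeft K q).restrict (p := homogeneousSubmodule (Fin 3) K (d - e)) (q := S)
        fun G hG => by
          have := hqe.mul ((mem_homogeneousSubmodule _ _).1 hG)
          rw [Nat.add_sub_cancel' hle] at this
          exact this)
    have hφ : Function.Injective φ := by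
      intro a b hab
      have := congrArg Subtype.val hab
      exact Subtype.ext (mul_left_cancel₀ hq this)
    have hrank : Module.finrank K (S ⧸ LinearMap.range φ) = e * d + 1 := by
      have h1 := (LinearMap.range φ).finrank_quotient_add_finrank
      rw [LinearMap.finrank_range_of_inj hφ, finrank_homogeneousSubmodule_three,
        finrank_homogeneousSubmodule_three] at h1
      have key : ∀ n : ℕ, ((n + 2).choose 2) * 2 = (n + 2) * (n + 1) := fun n => by
        rw [Nat.choose_two_right, Nat.div_mul_cancel]; · rfl
        exact (Nat.even_mul_pred_self (n + 2)).two_dvd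
      have k1 := key d
      have k2 := key (d - e)
      obtain ⟨n, hn⟩ := Nat.exists_eq_add_of_le hle
      rw [hn, Nat.add_sub_cancel_left] at k2
      generalize Module.finrank K (S ⧸ LinearMap.range φ) = N at h1 ⊢
      rw [hn, Nat.add_sub_cancel_left] at h1
      rw [hn] at k1
      rw [hn]
      rcases he with rfl | rfl <;> nlinarith
    let B := Module.finBasisOfFinrankEq K (S ⧸ LinearMap.range φ) hrank
    choose g hg using fun j => (LinearMap.range φ).mkQ_surjective (B j)
    refine ⟨fun j => (g j : MvPolynomial (Fin 3) K), fun F hF => ?_⟩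
    let F' : S := ⟨F, hF⟩
    let b := B.repr ((LinearMap.range φ).mkQ F')
    have hmem : F' - ∑ j, b j • g j ∈ LinearMap.range φ := by
      rw [← Submodule.ker_mkQ (LinearMap.range φ), LinearMap.mem_ker, map_sub, map_sum]
      simp only [map_smul, hg, b]
      rw [B.sum_repr, sub_self]
    obtain ⟨G, hG⟩ := hmem
    refine ⟨b, G, ?_⟩
    have := congrArg Subtype.val hG
    simp only [Submodule.coe_sub, Submodule.coe_sum, Submodule.coe_smul, F'] at this
    rw [← sub_eq_iff_eq_add', ← this]
    rfl

section Relations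

variable {K ι : Type*} [Field K] [Fintype ι] {n : ℕ}

/-- The weights `c` on the points `v` annihilate all forms of degree `d`. -/
def IsRel (d : ℕ) (v : ι → Fin n → K) (c : ι → K) : Prop :=
  ∀ H : MvPolynomial (Fin n) K, H.IsHomogeneous d → ∑ i, c i * eval (v i) H = 0

open Classical in
/-- The set of indices at which `c` does not vanish. -/
noncomputable def coeffSupport (c : ι → K) : Finset ι := Finset.univ.filter fun i => c i ≠ 0

/-- The points `v` are nonzero and pairwise non-proportional. -/
def ProjInjective (v : ι → Fin n → K) : Prop :=
  (∀ i, v i ≠ 0) ∧ ∀ i j, i ≠ j → v j ∉ Submodule.span K {v i}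

/-- A linear functional, as a linear form. -/
noncomputable def linForm (φ : Module.Dual K (Fin n → K)) : MvPolynomial (Fin n) K :=
  ∑ j, C (φ (Pi.single j 1)) * X j

@[simp] lemma mem_coeffSupport {c : ι → K} {i : ι} : i ∈ coeffSupport c ↔ c i ≠ 0 := by
  simp [coeffSupport]

@[simp] lemma eval_linForm (φ : Module.Dual K (Fin n → K)) (x : Fin n → K) :
    eval x (linForm φ) = φ x := by
  conv_rhs => rw [pi_eq_sum_univ' x, map_sum]
  simp only [linForm, map_sum, map_mul, eval_C, eval_X, map_smul, smul_eq_mul]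
  refine Finset.sum_congr rfl fun j _ => ?_
  rw [mul_comm]

lemma isHomogeneous_linForm (φ : Module.Dual K (Fin n → K)) : (linForm φ).IsHomogeneous 1 :=
  IsHomogeneous.sum _ _ _ fun j _ => (isHomogeneous_X K j).C_mul _

lemma linForm_ne_zero {φ : Module.Dual K (Fin n → K)} (hφ : φ ≠ 0) : linForm φ ≠ 0 := by
  intro h
  exact hφ (LinearMap.ext fun x => by rw [← eval_linForm, h]; simp)

lemma IsRel.mul {d e : ℕ} {v : ι → Fin n → K} {c : ι → K} (h : IsRel (d + e) v c)
    {G : MvPolynomial (Fin n) K} (hG : G.IsHomogeneous e) :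
    IsRel d v fun i => c i * eval (v i) G := by
  intro H hH
  have := h (H * G) (hH.mul hG)
  rw [← this]
  exact Finset.sum_congr rfl fun i _ => by rw [map_mul]; ring

lemma IsRel.mul_dual {d : ℕ} {v : ι → Fin n → K} {c : ι → K} (h : IsRel (d + 1) v c)
    (φ : Module.Dual K (Fin n → K)) : IsRel d v fun i => c i * φ (v i) := by
  simpa using h.mul (isHomogeneous_linForm φ)

/-- Composition of a form with a linear map. -/
noncomputable def pullbackForm {m : ℕ} (P : (Fin m → K) →ₗ[K] (Fin n → K))
    (H : MvPolynomial (Fin n) K) : MvPolynomial (Fin m) K :=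
  aeval (fun j => linForm ((LinearMap.proj j).comp P)) H

@[simp] lemma eval_pullbackForm {m : ℕ} (P : (Fin m → K) →ₗ[K] (Fin n → K))
    (H : MvPolynomial (Fin n) K) (x : Fin m → K) : eval x (pullbackForm P H) = eval (P x) H := by
  have h : (aeval x : MvPolynomial (Fin m) K →ₐ[K] K).comp
      (aeval (fun j => linForm ((LinearMap.proj j).comp P))) = aeval (P x) := by
    ext i
    simp
  simpa [MvPolynomial.coe_aeval_eq_eval, pullbackForm] using DFunLike.congr_fun h H

lemma isHomogeneous_pullbackForm {m d : ℕ} {H : MvPolynomial (Fin n) K}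
    (hH : H.IsHomogeneous d) (P : (Fin m → K) →ₗ[K] (Fin n → K)) :
    (pullbackForm P H).IsHomogeneous d := by
  simpa [pullbackForm] using hH.aeval (n := 1) (fun j => linForm ((LinearMap.proj j).comp P))
    fun j => isHomogeneous_linForm _

lemma IsRel.map {m d : ℕ} {v : ι → Fin m → K} {c : ι → K} (h : IsRel d v c)
    (P : (Fin m → K) →ₗ[K] (Fin n → K)) : IsRel d (fun i => P (v i)) c := by
  intro H hH
  simpa using h _ (isHomogeneous_pullbackForm hH P)

lemma card_add_card_le_coeffSupport {c : ι → K} {S T : Finset ι}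
    (hS : S ⊆ coeffSupport c) (hT : T ⊆ coeffSupport c) (hST : ∀ i ∈ S, i ∉ T) :
    S.card + T.card ≤ (coeffSupport c).card := by
  classical
  rw [← Finset.card_union_of_disjoint (Finset.disjoint_left.2 fun i => hST i)]
  exact Finset.card_le_card (Finset.union_subset hS hT)

/-- Multiplying a relation by an equation of a linear subspace `L` removes the points of `L`. -/
lemma IsRel.residual {d : ℕ} {v : ι → Fin n → K} {c : ι → K} (h : IsRel (d + 1) v c)
    {L : Submodule K (Fin n → K)} {k : ι} (hk : c k ≠ 0) (hkL : v k ∉ L) :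
    ∃ c' : ι → K, IsRel d v c' ∧ c' k ≠ 0 ∧ coeffSupport c' ⊆ coeffSupport c ∧
      ∀ i ∈ coeffSupport c', v i ∉ L := by
  obtain ⟨φ, hφ, hL⟩ := Submodule.exists_le_ker_of_notMem hkL
  refine ⟨_, h.mul_dual φ, mul_ne_zero hk hφ, fun i hi => ?_, fun i hi hiL => ?_⟩
  · rw [mem_coeffSupport] at hi ⊢
    exact left_ne_zero_of_mul hi
  · rw [mem_coeffSupport] at hi
    exact right_ne_zero_of_mul hi (hL hiL)

variable {v : ι → Fin n → K}

lemma IsRel.add_two_le_card {d : ℕ} {c : ι → K} (hv : ProjInjective v) (h : IsRel d v c) {k : ι}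
    (hk : c k ≠ 0) : d + 2 ≤ (coeffSupport c).card := by
  classical
  induction d generalizing c k with
  | zero =>
    by_contra! hlt
    have hsum := h 1 (isHomogeneous_one _ _)
    simp only [map_one, mul_one] at hsum
    rw [Finset.sum_eq_single k (fun j _ hj => ?_) (by simp)] at hsum
    · exact hk hsum
    · by_contra hcj
      exact hj (Finset.card_le_one.1 (Nat.lt_succ_iff.1 hlt) j (by simpa) k (by simpa))
  | succ d ih =>
    obtain ⟨c₁, h₁, hk₁, hs₁, -⟩ := h.residual (L := ⊥) hk (by simpa using hv.1 k)
    have h2 := (ih h₁ hk₁).trans (Finset.card_le_card hs₁)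
    obtain ⟨j, hj, hjk⟩ := Finset.exists_mem_ne (by omega : 1 < (coeffSupport c).card) k
    obtain ⟨c₂, h₂, hk₂, hs₂, hL₂⟩ := h.residual hk (hv.2 j k hjk)
    have := card_add_card_le_coeffSupport hs₂ (Finset.singleton_subset_iff.2 hj)
      fun i hi hij => hL₂ i hi (by
        rw [Finset.mem_singleton.1 hij]
        exact Submodule.mem_span_singleton_self _)
    have := ih h₂ hk₂
    rw [Finset.card_singleton] at *
    omega

lemma finrank_span_pair_le (a b : Fin n → K) :
    Module.finrank K (Submodule.span K {a, b}) ≤ 2 := by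
  classical
  have := finrank_span_finset_le_card (R := K) ({a, b} : Finset (Fin n → K))
  rw [Finset.coe_pair] at this
  exact this.trans Finset.card_le_two

lemma IsRel.exists_line {d : ℕ} {c : ι → K} (hv : ProjInjective v) (h : IsRel d v c)
    (hc : (coeffSupport c).card ≤ 2 * d + 1) :
    ∃ L : Submodule K (Fin n → K), Module.finrank K L ≤ 2 ∧ ∀ i ∈ coeffSupport c, v i ∈ L := by
  classical
  induction d generalizing c with
  | zero =>
    refine ⟨⊥, by simp, fun i hi => ?_⟩
    have := h.add_two_le_card hv (mem_coeffSupport.1 hi)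
    omega
  | succ d ih =>
    by_cases h0 : ∃ k, c k ≠ 0
    swap
    · push Not at h0
      exact ⟨⊥, by simp, fun i hi => absurd (h0 i) (mem_coeffSupport.1 hi)⟩
    obtain ⟨k₀, hk₀⟩ := h0
    obtain ⟨i, hi, j, hj, hij⟩ := Finset.one_lt_card.1
      (by have := h.add_two_le_card hv hk₀; omega : 1 < (coeffSupport c).card)
    by_contra! hL
    obtain ⟨k, hk, hkL⟩ := hL _ (finrank_span_pair_le (v i) (v j))
    obtain ⟨c₁, h₁, hk₁, hs₁, hL₁⟩ := h.residual (mem_coeffSupport.1 hk) hkL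
    have e₁ := card_add_card_le_coeffSupport hs₁ (T := {i, j})
      (by simp only [Finset.insert_subset_iff, Finset.singleton_subset_iff]; exact ⟨hi, hj⟩)
      (by
        intro l hl hl'
        refine hL₁ l hl (Submodule.subset_span ?_)
        rcases Finset.mem_insert.1 hl' with rfl | hl'
        · simp
        · rw [Finset.mem_singleton.1 hl']; simp)
    rw [Finset.card_pair hij] at e₁
    obtain ⟨L, hLr, hL'⟩ := ih h₁ (by omega)
    obtain ⟨k', hk', hkL'⟩ := hL L hLr
    obtain ⟨c₂, h₂, hk₂, hs₂, hL₂⟩ := h.residual (mem_coeffSupport.1 hk') hkL'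
    have e₂ := card_add_card_le_coeffSupport hs₂ hs₁ fun l hl hl' => hL₂ l hl (hL' l hl')
    have := h₁.add_two_le_card hv hk₁
    have := h₂.add_two_le_card hv hk₂
    omega

/-- The relations in degree `d` supported on `T`. -/
def relSpace (d : ℕ) (v : ι → Fin n → K) (T : Finset ι) : Submodule K (ι → K) where
  carrier := {c | IsRel d v c ∧ ∀ i ∉ T, c i = 0}
  add_mem' := by
    rintro a b ⟨ha, ha'⟩ ⟨hb, hb'⟩
    refine ⟨fun H hH => ?_, fun i hi => by simp [ha' i hi, hb' i hi]⟩
    simp [add_mul, Finset.sum_add_distrib, ha H hH, hb H hH]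
  zero_mem' := ⟨fun H _ => by simp, fun i _ => rfl⟩
  smul_mem' := by
    rintro θ a ⟨ha, ha'⟩
    refine ⟨fun H hH => ?_, fun i hi => by simp [ha' i hi]⟩
    simp [mul_assoc, ← Finset.mul_sum, ha H hH]

lemma mem_relSpace {d : ℕ} {T : Finset ι} {c : ι → K} :
    c ∈ relSpace d v T ↔ IsRel d v c ∧ ∀ i ∉ T, c i = 0 := Iff.rfl

lemma finrank_relSpace_le_erase [DecidableEq ι] (d : ℕ) (T : Finset ι) (p : ι) :
    Module.finrank K (relSpace d v T) ≤ Module.finrank K (relSpace d v (T.erase p)) + 1 := by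
  let φ : relSpace d v T →ₗ[K] K := (LinearMap.proj p).comp (relSpace d v T).subtype
  have h1 := φ.finrank_range_add_finrank_ker
  have h2 : Module.finrank K (LinearMap.range φ) ≤ 1 :=
    (Submodule.finrank_le _).trans (Module.finrank_self K).le
  have h3 : Module.finrank K (LinearMap.ker φ) ≤ Module.finrank K (relSpace d v (T.erase p)) := by
    rw [LinearEquiv.finrank_eq ((LinearMap.ker φ).equivMapOfInjective (relSpace d v T).subtype
      (Submodule.subtype_injective _))]
    refine Submodule.finrank_mono ?_
    rintro _ ⟨⟨c, hc⟩, hcp, rfl⟩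
    refine mem_relSpace.2 ⟨hc.1, fun i hi => ?_⟩
    by_cases hip : i = p
    · subst hip; exact hcp
    · exact hc.2 i fun hiT => hi (Finset.mem_erase.2 ⟨hip, hiT⟩)
  omega

lemma finrank_relSpace_le_add {d N m : ℕ} {S : Finset ι}
    (hS : ∀ T ⊆ S, T.card ≤ N → Module.finrank K (relSpace d v T) ≤ 1)
    {T : Finset ι} (hT : T ⊆ S) (hc : T.card ≤ N + m) :
    Module.finrank K (relSpace d v T) ≤ 1 + m := by
  classical
  induction m generalizing T with
  | zero => exact hS T hT hc
  | succ m ih =>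
    by_cases hle : T.card ≤ N
    · exact (hS T hT hle).trans (by omega)
    obtain ⟨p, hp⟩ := Finset.card_pos.1 (by omega : 0 < T.card)
    have h1 := ih ((T.erase_subset p).trans hT) (by rw [Finset.card_erase_of_mem hp]; omega)
    have h2 := finrank_relSpace_le_erase (v := v) d T p
    omega

lemma exists_pair_of_one_lt_finrank {V : Type*} [AddCommGroup V] [Module K V] {W : Submodule K V}
    (h : 1 < Module.finrank K W) :
    ∃ c ∈ W, c ≠ 0 ∧ ∃ c' ∈ W, ∀ θ : K, θ • c ≠ c' := by
  have : Nontrivial W := Module.nontrivial_of_finrank_pos (R := K) (by omega)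
  obtain ⟨c, hc⟩ := exists_ne (0 : W)
  refine ⟨c, c.2, fun h0 => hc (Subtype.ext h0), ?_⟩
  by_contra! hcon
  refine absurd (finrank_le_one (R := K) c fun w => ?_) (not_le.2 h)
  obtain ⟨θ, hθ⟩ := hcon w w.2
  exact ⟨θ, Subtype.ext hθ⟩

lemma dual_eq_zero_of_mul_eq_zero {V : Type*} [AddCommGroup V] [Module K V] (W : Submodule K V)
    {a b : Module.Dual K V} (h : ∀ y ∈ W, a y * b y = 0) (hb : ∃ y ∈ W, b y ≠ 0) :
    ∀ y ∈ W, a y = 0 := by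
  obtain ⟨z, hzW, hz⟩ := hb
  have haz : a z = 0 := (mul_eq_zero.1 (h z hzW)).resolve_right hz
  intro y hy
  by_cases hby : b y = 0
  · have := h (y + z) (W.add_mem hy hzW)
    simpa [haz, hby, hz] using this
  · exact (mul_eq_zero.1 (h y hy)).resolve_right hby

lemma exists_smul_eq_of_ker_le {V : Type*} [AddCommGroup V] [Module K V] {a b : Module.Dual K V}
    (h : ∀ y, a y = 0 → b y = 0) : ∃ θ : K, b = θ • a := by
  by_cases ha : a = 0
  · exact ⟨0, LinearMap.ext fun y => by simp [h y (by simp [ha])]⟩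
  obtain ⟨z, hz⟩ : ∃ z, a z ≠ 0 := by
    by_contra! hcon
    exact ha (LinearMap.ext hcon)
  refine ⟨b z / a z, LinearMap.ext fun y => ?_⟩
  have := h (y - (a y / a z) • z) (by simp [hz])
  simp only [map_sub, map_smul, smul_eq_mul, sub_eq_zero] at this
  rw [this, LinearMap.smul_apply, smul_eq_mul]
  ring

end Relations

section Plane

variable {K ι : Type*} [Field K] [Fintype ι] {v : ι → Fin 3 → K}

lemma exists_dual_ne_zero_of_finrank_lt {n : ℕ} {L : Submodule K (Fin n → K)}
    (hL : Module.finrank K L < n) : ∃ φ : Module.Dual K (Fin n → K), φ ≠ 0 ∧ ∀ y ∈ L, φ y = 0 := by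
  obtain ⟨φ, hφ, h⟩ := Submodule.exists_le_ker_of_lt_top L (lt_top_iff_ne_top.2 fun h => by
    rw [h, finrank_top, Module.finrank_fin_fun] at hL; exact lt_irrefl _ hL)
  exact ⟨φ, hφ, fun y hy => h hy⟩

lemma finrank_ker_dual_le_two {φ : Module.Dual K (Fin 3 → K)} (hφ : φ ≠ 0) :
    Module.finrank K (LinearMap.ker φ) ≤ 2 := by
  have := (Submodule.finrank_lt (fun h => hφ (LinearMap.ker_eq_top.1 h)) :
    Module.finrank K (LinearMap.ker φ) < _)
  rw [Module.finrank_fin_fun] at this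
  omega

/-- Among points of the plane with at most two on a line and at most five on a conic, few points
satisfy at most one relation. -/
lemma finrank_relSpace_le_one (hv : ProjInjective v) {S : Finset ι}
    (hline : ∀ T ⊆ S, ∀ L : Submodule K (Fin 3 → K), Module.finrank K L ≤ 2 →
      (∀ i ∈ T, v i ∈ L) → T.card ≤ 2)
    (hconic : ∀ T ⊆ S, ∀ q : MvPolynomial (Fin 3) K, q ≠ 0 → q.IsHomogeneous 2 →
      (∀ i ∈ T, eval (v i) q = 0) → T.card ≤ 5)
    (k : ℕ) : ∀ T ⊆ S, T.card ≤ 3 * k + 4 → Module.finrank K (relSpace (k + 1) v T) ≤ 1 := by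
  classical
  have hsub : ∀ {d : ℕ} {T : Finset ι} {c : ι → K}, c ∈ relSpace d v T → coeffSupport c ⊆ T := by
    intro d T c hc i hi
    by_contra hiT
    exact mem_coeffSupport.1 hi (hc.2 i hiT)
  have hlarge : ∀ {d : ℕ} {T : Finset ι} {c : ι → K}, 1 ≤ d → T ⊆ S → c ∈ relSpace d v T →
      c ≠ 0 → 2 * d + 2 ≤ (coeffSupport c).card := by
    intro d T c hd hT hc hc0
    by_contra! hlt
    obtain ⟨L, hL, hcL⟩ := hc.1.exists_line hv (by omega)
    have h2 := hline _ ((hsub hc).trans hT) L hL hcL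
    obtain ⟨j, hj⟩ := Function.ne_iff.1 hc0
    have := hc.1.add_two_le_card hv hj
    omega
  induction k with
  | zero =>
    intro T hT hcard
    by_contra! hlt
    obtain ⟨c, hc, hc0, c', hc', hind⟩ := exists_pair_of_one_lt_finrank hlt
    obtain ⟨p, hp⟩ := Function.ne_iff.1 hc0
    have hmem : c' - (c' p / c p) • c ∈ relSpace 1 v (T.erase p) := by
      have h := Submodule.sub_mem _ hc' (Submodule.smul_mem _ (c' p / c p) hc)
      refine mem_relSpace.2 ⟨h.1, fun i hi => ?_⟩
      by_cases hip : i = p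
      · subst hip
        have : c i ≠ 0 := hp
        simp [this]
      · exact h.2 i fun hiT => hi (Finset.mem_erase.2 ⟨hip, hiT⟩)
    have h1 := hlarge le_rfl ((T.erase_subset p).trans hT) hmem
      (sub_ne_zero.2 fun h => hind _ h.symm)
    have h2 := Finset.card_le_card (hsub hmem)
    have h3 : p ∈ T := hsub hc (mem_coeffSupport.2 hp)
    rw [Finset.card_erase_of_mem h3] at h2
    omega
  | succ k ih =>
    intro T hT hcard
    by_contra! hlt
    obtain ⟨c, hc, hc0, c', hc', hind⟩ := exists_pair_of_one_lt_finrank hlt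
    have hdim := finrank_relSpace_le_add (m := 3) ih hT (by omega)
    let Φ : Module.Dual K (Fin 3 → K) × Module.Dual K (Fin 3 → K) →ₗ[K] relSpace (k + 1) v T :=
      { toFun := fun ab => ⟨fun i => c i * ab.1 (v i) + c' i * ab.2 (v i), by
          refine Submodule.add_mem _ (x := fun i => c i * ab.1 (v i))
            (y := fun i => c' i * ab.2 (v i)) ⟨hc.1.mul_dual _, fun i hi => ?_⟩
            ⟨hc'.1.mul_dual _, fun i hi => ?_⟩
          · simp [hc.2 i hi]
          · simp [hc'.2 i hi]⟩
        map_add' := fun ab ab' => Subtype.ext (funext fun i => by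
          simp only [Prod.fst_add, Prod.snd_add, LinearMap.add_apply, Submodule.coe_add,
            Pi.add_apply]
          ring)
        map_smul' := fun θ ab => Subtype.ext (funext fun i => by
          simp only [Prod.smul_fst, Prod.smul_snd, LinearMap.smul_apply, Submodule.coe_smul,
            Pi.smul_apply, smul_eq_mul, RingHom.id_apply]
          ring) }
    have hΦ : ∀ ab ∈ LinearMap.ker Φ, ∀ i, c i * ab.1 (v i) + c' i * ab.2 (v i) = 0 := by
      intro ab hab i
      exact congrFun (congrArg Subtype.val (LinearMap.mem_ker.1 hab)) i
    have hker : 1 < Module.finrank K (LinearMap.ker Φ) := by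
      have h1 := Φ.finrank_range_add_finrank_ker
      have h2 := Submodule.finrank_le (LinearMap.range Φ)
      rw [Module.finrank_prod, Subspace.dual_finrank_eq, Module.finrank_fin_fun] at h1
      omega
    obtain ⟨⟨a, b⟩, hab, hab0, ⟨a', b'⟩, hab', hind'⟩ := exists_pair_of_one_lt_finrank hker
    have hfact : ∀ e ∈ relSpace (k + 1 + 1) v T, e ≠ 0 → ∀ ℓ : Module.Dual K (Fin 3 → K),
        (∀ i, e i * ℓ (v i) = 0) → ℓ = 0 := by
      intro e he he0 ℓ hℓ
      by_contra hℓ0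
      have h1 := hlarge (by omega) hT he he0
      have h2 := hline _ ((hsub he).trans hT) (LinearMap.ker ℓ) (finrank_ker_dual_le_two hℓ0)
        fun i hi => (mul_eq_zero.1 (hℓ i)).resolve_left (mem_coeffSupport.1 hi)
      omega
    have hc'0 : c' ≠ 0 := fun h => hind 0 (by simp [h])
    have ha : a ≠ 0 := by
      rintro rfl
      refine hab0 (Prod.ext rfl (hfact c' hc' hc'0 b fun i => ?_))
      simpa using hΦ _ hab i
    have hb : ∀ θ : K, b ≠ θ • a := by
      rintro θ rfl
      refine ha (hfact (c + θ • c') (Submodule.add_mem _ hc (Submodule.smul_mem _ _ hc')) ?_ a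
        fun i => ?_)
      · intro h
        have hθ : θ ≠ 0 := by
          rintro rfl
          exact hc0 (by simpa using h)
        refine hind (-θ⁻¹) ?_
        rw [eq_neg_of_add_eq_zero_left h]
        simp [smul_smul, hθ]
      · have := hΦ _ hab i
        simp only [LinearMap.smul_apply, smul_eq_mul] at this
        rw [← this, Pi.add_apply, Pi.smul_apply, smul_eq_mul]
        ring
    have hQ : linForm a * linForm b' - linForm a' * linForm b = 0 := by
      by_contra hQ0
      have h1 := hlarge (by omega) hT hc hc0
      have h2 := hconic _ ((hsub hc).trans hT) _ hQ0
        (((isHomogeneous_linForm a).mul (isHomogeneous_linForm b')).sub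
          ((isHomogeneous_linForm a').mul (isHomogeneous_linForm b))) fun i hi => by
            have e1 := hΦ _ hab i
            have e2 := hΦ _ hab' i
            simp only at e1 e2
            refine (mul_eq_zero.1 (?_ : c i * _ = 0)).resolve_left (mem_coeffSupport.1 hi)
            simp only [map_sub, map_mul, eval_linForm]
            linear_combination b' (v i) * e1 - b (v i) * e2
      omega
    have hQ' : ∀ y, a y * b' y = a' y * b y := by
      intro y
      have := congrArg (eval y) hQ
      simpa [sub_eq_zero] using this
    obtain ⟨θ, rfl⟩ : ∃ θ : K, a' = θ • a := by
      refine exists_smul_eq_of_ker_le fun y hy => dual_eq_zero_of_mul_eq_zero (LinearMap.ker a)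
        (b := b) (fun z hz => ?_) ?_ y hy
      · rw [← hQ', LinearMap.mem_ker.1 hz, zero_mul]
      · by_contra! hcon
        obtain ⟨θ, hθ⟩ := exists_smul_eq_of_ker_le hcon
        exact hb θ hθ
    refine hind' θ (Prod.ext rfl (LinearMap.ext fun y => ?_))
    have h0 := dual_eq_zero_of_mul_eq_zero ⊤ (a := b' - θ • b) (b := a) (fun z _ => by
      have := hQ' z
      simp only [LinearMap.smul_apply, smul_eq_mul, LinearMap.sub_apply] at this ⊢
      linear_combination this) (by
        by_contra! hcon
        exact ha (LinearMap.ext fun z => hcon z trivial)) y trivial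
    exact (sub_eq_zero.1 h0).symm

lemma exists_conic_of_general (hv : ProjInjective v) {d : ℕ} {c : ι → K} (hd : 3 ≤ d)
    (h : IsRel d v c) (hc : (coeffSupport c).card + 1 ≤ 3 * d)
    (hline : ∀ T ⊆ coeffSupport c, ∀ L : Submodule K (Fin 3 → K), Module.finrank K L ≤ 2 →
      (∀ i ∈ T, v i ∈ L) → T.card ≤ 2)
    (hconic : ∀ T ⊆ coeffSupport c, ∀ q : MvPolynomial (Fin 3) K, q ≠ 0 → q.IsHomogeneous 2 →
      (∀ i ∈ T, eval (v i) q = 0) → T.card ≤ 5) :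
    ∃ q : MvPolynomial (Fin 3) K, q ≠ 0 ∧ q.IsHomogeneous 2 ∧
      ∀ i ∈ coeffSupport c, eval (v i) q = 0 := by
  obtain ⟨k, rfl⟩ := Nat.exists_eq_add_of_le hd
  have hdim := finrank_relSpace_le_add (m := 4) (finrank_relSpace_le_one hv hline hconic k)
    subset_rfl (by omega)
  have h' : IsRel (k + 1 + 2) v c := by rwa [show k + 1 + 2 = 3 + k by omega]
  let Ψ : homogeneousSubmodule (Fin 3) K 2 →ₗ[K] relSpace (k + 1) v (coeffSupport c) :=
    { toFun := fun q => ⟨fun i => c i * eval (v i) (q : MvPolynomial (Fin 3) K),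
        h'.mul ((mem_homogeneousSubmodule _ _).1 q.2), fun i hi => by
          rw [mem_coeffSupport, not_not] at hi
          simp only [hi, zero_mul]⟩
      map_add' := fun q q' => Subtype.ext (funext fun i => by
        simp only [Submodule.coe_add, map_add, Pi.add_apply]
        ring)
      map_smul' := fun θ q => Subtype.ext (funext fun i => by
        simp only [Submodule.coe_smul, smul_eval, Pi.smul_apply, smul_eq_mul, RingHom.id_apply]
        ring) }
  have : Module.Finite K (homogeneousSubmodule (Fin 3) K 2) :=
    Module.Finite.iff_fg.2 (homogeneousSubmodule_fg (Fin 3) K 2)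
  have hker : LinearMap.ker Ψ ≠ ⊥ := LinearMap.ker_ne_bot_of_finrank_lt (by
    rw [finrank_homogeneousSubmodule_three]
    exact hdim.trans_lt (by decide))
  obtain ⟨q, hq, hq0⟩ := (Submodule.ne_bot_iff _).1 hker
  refine ⟨q, fun h => hq0 (Subtype.ext h), (mem_homogeneousSubmodule _ _).1 q.2, fun i hi => ?_⟩
  have := congrFun (congrArg Subtype.val (LinearMap.mem_ker.1 hq)) i
  exact (mul_eq_zero.1 this).resolve_left (mem_coeffSupport.1 hi)

/-- A relation of degree `d` between fewer than `3 * d` points of the plane has its support on a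
conic. -/
lemma IsRel.exists_conic (hv : ProjInjective v) {d : ℕ} {c : ι → K} (h : IsRel d v c)
    (hc : (coeffSupport c).card + 1 ≤ 3 * d) :
    ∃ q : MvPolynomial (Fin 3) K, q ≠ 0 ∧ q.IsHomogeneous 2 ∧
      ∀ i ∈ coeffSupport c, eval (v i) q = 0 := by
  induction d using Nat.strong_induction_on generalizing c with
  | _ d ih =>
  have hsupp : ∀ (q : MvPolynomial (Fin 3) K),
      coeffSupport (fun i => c i * eval (v i) q) ⊆ coeffSupport c := fun q i hi => by
    rw [mem_coeffSupport] at hi ⊢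
    exact left_ne_zero_of_mul hi
  have hne : ∀ (q : MvPolynomial (Fin 3) K),
      ∀ i ∈ coeffSupport (fun i => c i * eval (v i) q), eval (v i) q ≠ 0 := fun q i hi => by
    rw [mem_coeffSupport] at hi
    exact right_ne_zero_of_mul hi
  have heq : ∀ (q : MvPolynomial (Fin 3) K), ∀ i ∈ coeffSupport c,
      i ∉ coeffSupport (fun i => c i * eval (v i) q) → eval (v i) q = 0 := fun q i hi hi' => by
    rw [mem_coeffSupport, not_not] at hi'
    exact (mul_eq_zero.1 hi').resolve_left (mem_coeffSupport.1 hi)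
  by_cases hsmall : (coeffSupport c).card ≤ 2 * d + 1
  · obtain ⟨L, hL, hcL⟩ := h.exists_line hv hsmall
    obtain ⟨φ, hφ, hφL⟩ := exists_dual_ne_zero_of_finrank_lt (show Module.finrank K L < 3 by omega)
    refine ⟨linForm φ * linForm φ, mul_ne_zero (linForm_ne_zero hφ) (linForm_ne_zero hφ),
      (isHomogeneous_linForm φ).mul (isHomogeneous_linForm φ), fun i hi => ?_⟩
    simp [hφL _ (hcL i hi)]
  by_cases hline : ∀ T ⊆ coeffSupport c, ∀ L : Submodule K (Fin 3 → K), Module.finrank K L ≤ 2 →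
      (∀ i ∈ T, v i ∈ L) → T.card ≤ 2
  · by_cases hconic : ∀ T ⊆ coeffSupport c, ∀ q : MvPolynomial (Fin 3) K, q ≠ 0 →
        q.IsHomogeneous 2 → (∀ i ∈ T, eval (v i) q = 0) → T.card ≤ 5
    · exact exists_conic_of_general hv (by omega) h hc hline hconic
    push Not at hconic
    obtain ⟨T, hT, q, hq0, hq, hTq, hTc⟩ := hconic
    obtain ⟨m, rfl⟩ := Nat.exists_eq_add_of_le' (show 2 ≤ d by omega)
    have hlarge : ∀ q' : MvPolynomial (Fin 3) K, q'.IsHomogeneous 2 →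
        (∃ i ∈ coeffSupport c, eval (v i) q' ≠ 0) →
        2 * m + 2 ≤ (coeffSupport fun i => c i * eval (v i) q').card := by
      rintro q' hq' ⟨i, hi, hiq⟩
      by_contra! hlt
      obtain ⟨L, hL, hcL⟩ := (h.mul hq').exists_line hv (by omega)
      have h1 := hline _ (hsupp q') L hL hcL
      have h2 := (h.mul hq').add_two_le_card hv (mul_ne_zero (mem_coeffSupport.1 hi) hiq)
      omega
    by_contra! hcon
    have h1 := hlarge q hq (hcon q hq0 hq)
    have h2 := card_add_card_le_coeffSupport (hsupp q) hT fun i hi hiT => hne q i hi (hTq i hiT)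
    obtain ⟨q', hq'0, hq', hcq'⟩ := ih m (by omega) (h.mul hq) (by omega)
    have h3 := hlarge q' hq' (hcon q' hq'0 hq')
    have h4 := card_add_card_le_coeffSupport (hsupp q) (hsupp q')
      fun i hi hi' => hne q' i hi' (hcq' i hi)
    omega
  · push Not at hline
    obtain ⟨T, hT, L, hL, hTL, hTc⟩ := hline
    obtain ⟨φ, hφ, hφL⟩ := exists_dual_ne_zero_of_finrank_lt (show Module.finrank K L < 3 by omega)
    obtain ⟨m, rfl⟩ := Nat.exists_eq_add_of_le' (show 2 ≤ d by omega)
    have hrel : IsRel (m + 1) v _ := IsRel.mul (d := m + 1) h (isHomogeneous_linForm φ)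
    have h1 := card_add_card_le_coeffSupport (hsupp (linForm φ)) hT
      fun i hi hiT => hne _ i hi (by rw [eval_linForm]; exact hφL _ (hTL i hiT))
    obtain ⟨q', hq'0, hq', hcq'⟩ := ih (m + 1) (by omega) hrel (by omega)
    by_cases hex : ∃ i ∈ coeffSupport c, eval (v i) q' ≠ 0
    swap
    · push Not at hex
      exact ⟨q', hq'0, hq', hex⟩
    obtain ⟨i, hi, hiq⟩ := hex
    have h2 := (h.mul hq').add_two_le_card hv (mul_ne_zero (mem_coeffSupport.1 hi) hiq)
    have h3 := card_add_card_le_coeffSupport (hsupp (linForm φ)) (hsupp q')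
      fun i hi hi' => hne q' i hi' (hcq' i hi)
    obtain ⟨L', hL', hcL'⟩ := hrel.exists_line hv (by omega)
    obtain ⟨φ', hφ', hφL'⟩ :=
      exists_dual_ne_zero_of_finrank_lt (show Module.finrank K L' < 3 by omega)
    refine ⟨linForm φ * linForm φ', mul_ne_zero (linForm_ne_zero hφ) (linForm_ne_zero hφ'),
      (isHomogeneous_linForm φ).mul (isHomogeneous_linForm φ'), fun j hj => ?_⟩
    rw [map_mul]
    by_cases hj' : j ∈ coeffSupport fun i => c i * eval (v i) (linForm φ)
    · rw [eval_linForm φ', hφL' _ (hcL' j hj'), mul_zero]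
    · rw [heq _ j hj hj', zero_mul]

end Plane

section Curve

variable {K ι : Type*} [Field K] [Fintype ι] {n : ℕ} {v : ι → Fin n → K}

/-- If `d` of the points of a short relation are collinear, then two lines carry its support. -/
lemma IsRel.exists_two_lines (hv : ProjInjective v) {d : ℕ} {c : ι → K} (h : IsRel d v c)
    (hc : (coeffSupport c).card + 1 ≤ 3 * d) {L : Submodule K (Fin n → K)}
    (hL : Module.finrank K L ≤ 2) {T : Finset ι} (hT : T ⊆ coeffSupport c)
    (hTL : ∀ i ∈ T, v i ∈ L) (hTd : d ≤ T.card) :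
    ∃ L₁ L₂ : Submodule K (Fin n → K), Module.finrank K L₁ ≤ 2 ∧ Module.finrank K L₂ ≤ 2 ∧
      ∀ i ∈ coeffSupport c, v i ∈ L₁ ∨ v i ∈ L₂ := by
  obtain ⟨m, rfl⟩ := Nat.exists_eq_add_of_le' (show 1 ≤ d by omega)
  by_contra! hcon
  obtain ⟨k, hk, hkL, -⟩ := hcon L L hL hL
  obtain ⟨c₁, h₁, hk₁, hs₁, hL₁⟩ := h.residual (mem_coeffSupport.1 hk) hkL
  have e₁ := card_add_card_le_coeffSupport hs₁ hT fun i hi hi' => hL₁ i hi (hTL i hi')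
  obtain ⟨L', hL', hcL'⟩ := h₁.exists_line hv (by omega)
  have a₁ := h₁.add_two_le_card hv hk₁
  obtain ⟨k', hk', hkL', -⟩ := hcon L' L' hL' hL'
  obtain ⟨c₂, h₂, hk₂, hs₂, hL₂⟩ := h.residual (mem_coeffSupport.1 hk') hkL'
  have d₁₂ : ∀ i ∈ coeffSupport c₂, i ∉ coeffSupport c₁ := fun i hi hi' => hL₂ i hi (hcL' i hi')
  have e₂ := card_add_card_le_coeffSupport hs₂ hs₁ d₁₂
  obtain ⟨L'', hL'', hcL''⟩ := h₂.exists_line hv (by omega)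
  have a₂ := h₂.add_two_le_card hv hk₂
  obtain ⟨k'', hk'', hkL'', hkL'''⟩ := hcon L' L'' hL' hL''
  obtain ⟨c₃, h₃, hk₃, hs₃, hL₃⟩ := h.residual (mem_coeffSupport.1 hk'') hkL''
  obtain ⟨m, rfl⟩ := Nat.exists_eq_add_of_le' (show 1 ≤ m by omega)
  obtain ⟨c₄, h₄, hk₄, hs₄, hL₄⟩ := h₃.residual hk₃ hkL'''
  have a₄ := h₄.add_two_le_card hv hk₄
  classical
  have e₄ := card_add_card_le_coeffSupport (S := coeffSupport c₂ ∪ coeffSupport c₁)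
    (T := coeffSupport c₄) (c := c)
    (Finset.union_subset hs₂ hs₁) (hs₄.trans hs₃) fun i hi hi' => by
      rcases Finset.mem_union.1 hi with hi | hi
      · exact hL₄ i hi' (hcL'' i hi)
      · exact hL₃ i (hs₄ hi') (hcL' i hi)
  rw [Finset.card_union_of_disjoint (Finset.disjoint_left.2 d₁₂)] at e₄
  omega

lemma finrank_span_triple_le (a b c : Fin n → K) :
    Module.finrank K (Submodule.span K {a, b, c}) ≤ 3 := by
  classical
  have := finrank_span_finset_le_card (R := K) ({a, b, c} : Finset (Fin n → K))
  simp only [Finset.coe_insert, Finset.coe_singleton] at this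
  exact this.trans Finset.card_le_three

/-- A relation of degree `d` between fewer than `3 * d` points has its support in a plane or on
two lines. -/
lemma IsRel.exists_plane_or_two_lines (hv : ProjInjective v) {d : ℕ} {c : ι → K} (h : IsRel d v c)
    (hc : (coeffSupport c).card + 1 ≤ 3 * d) :
    (∃ M : Submodule K (Fin n → K), Module.finrank K M ≤ 3 ∧ ∀ i ∈ coeffSupport c, v i ∈ M) ∨
    ∃ L₁ L₂ : Submodule K (Fin n → K), Module.finrank K L₁ ≤ 2 ∧ Module.finrank K L₂ ≤ 2 ∧
      ∀ i ∈ coeffSupport c, v i ∈ L₁ ∨ v i ∈ L₂ := by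
  classical
  induction d generalizing c with
  | zero => omega
  | succ m ih =>
    by_cases hsmall : (coeffSupport c).card ≤ 2 * (m + 1) + 1
    · obtain ⟨L, hL, hcL⟩ := h.exists_line hv hsmall
      exact Or.inl ⟨L, by omega, hcL⟩
    by_cases hline : ∃ T ⊆ coeffSupport c, ∃ L : Submodule K (Fin n → K),
        Module.finrank K L ≤ 2 ∧ (∀ i ∈ T, v i ∈ L) ∧ m + 1 ≤ T.card
    · obtain ⟨T, hT, L, hL, hTL, hTc⟩ := hline
      exact Or.inr (h.exists_two_lines hv hc hL hT hTL hTc)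
    push Not at hline
    left
    obtain ⟨i, hi, j, hj, hij⟩ := Finset.one_lt_card.1 (by omega : 1 < (coeffSupport c).card)
    obtain ⟨k, hk, hkL⟩ : ∃ k ∈ coeffSupport c, v k ∉ Submodule.span K {v i, v j} := by
      by_contra! hcon
      have := hline _ subset_rfl _ (finrank_span_pair_le (v i) (v j)) hcon
      omega
    by_contra! hM
    obtain ⟨l, hl, hlM⟩ := hM _ (finrank_span_triple_le (v i) (v j) (v k))
    obtain ⟨c₁, h₁, hk₁, hs₁, hL₁⟩ := h.residual (mem_coeffSupport.1 hl) hlM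
    have e₁ := card_add_card_le_coeffSupport hs₁ (T := {i, j, k})
      (by simp only [Finset.insert_subset_iff, Finset.singleton_subset_iff]; exact ⟨hi, hj, hk⟩)
      (by
        intro p hp hp'
        refine hL₁ p hp (Submodule.subset_span ?_)
        simp only [Finset.mem_insert, Finset.mem_singleton] at hp'
        rcases hp' with rfl | rfl | rfl <;> simp)
    rw [Finset.card_eq_three.2 ⟨i, j, k, hij,
      fun hik => hkL (hik ▸ Submodule.subset_span (by simp)),
      fun hjk => hkL (hjk ▸ Submodule.subset_span (by simp)), rfl⟩] at e₁
    have a₁ := h₁.add_two_le_card hv hk₁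
    have hlarge : 2 * m + 2 ≤ (coeffSupport c₁).card := by
      by_contra! hlt
      obtain ⟨L', hL', hcL'⟩ := h₁.exists_line hv (by omega)
      have := hline _ hs₁ L' hL' hcL'
      omega
    rcases ih h₁ (by omega) with ⟨M, hMr, hcM⟩ | ⟨L₁, L₂, hr₁, hr₂, hcL⟩
    · obtain ⟨p, hp, hpM⟩ := hM M hMr
      obtain ⟨c₂, h₂, hk₂, hs₂, hL₂⟩ := h.residual (mem_coeffSupport.1 hp) hpM
      have a₂ := h₂.add_two_le_card hv hk₂
      have := card_add_card_le_coeffSupport hs₂ hs₁ fun q hq hq' => hL₂ q hq (hcM q hq')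
      omega
    · have f₁ := hline ((coeffSupport c₁).filter fun i => v i ∈ L₁)
        ((Finset.filter_subset _ _).trans hs₁) L₁ hr₁ fun i hi => (Finset.mem_filter.1 hi).2
      have f₂ := hline ((coeffSupport c₁).filter fun i => ¬ v i ∈ L₁)
        ((Finset.filter_subset _ _).trans hs₁) L₂ hr₂ fun i hi =>
          (hcL i (Finset.mem_filter.1 hi).1).resolve_left (Finset.mem_filter.1 hi).2
      have := Finset.card_filter_add_card_filter_not (s := coeffSupport c₁) fun i => v i ∈ L₁
      omega

lemma exists_le_finrank_eq {L : Submodule K (Fin n → K)} {k : ℕ} (hL : Module.finrank K L ≤ k)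
    (hk : k ≤ n) : ∃ M : Submodule K (Fin n → K), L ≤ M ∧ Module.finrank K M = k := by
  induction k, hL using Nat.le_induction with
  | base => exact ⟨L, le_rfl, rfl⟩
  | succ k hLk ih =>
    obtain ⟨M, hLM, hM⟩ := ih (by omega)
    have : M ≠ ⊤ := fun h => by
      rw [h, finrank_top, Module.finrank_fin_fun] at hM
      omega
    obtain ⟨x, -, hx⟩ := SetLike.exists_of_lt (lt_top_iff_ne_top.2 this)
    refine ⟨M ⊔ Submodule.span K {x}, hLM.trans le_sup_left, ?_⟩
    rw [Submodule.finrank_sup_span_singleton hx, hM]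

/-- A three-dimensional subspace has coordinates, extended to the whole space. -/
lemma exists_coordinates {M : Submodule K (Fin n → K)} (hM : Module.finrank K M = 3) :
    ∃ (ψ : (Fin 3 → K) →ₗ[K] (Fin n → K)) (π : (Fin n → K) →ₗ[K] (Fin 3 → K)),
      (∀ y, π (ψ y) = y) ∧ ∀ x, ψ (π x) = x ↔ x ∈ M := by
  let e : (Fin 3 → K) ≃ₗ[K] M := LinearEquiv.ofFinrankEq _ _ (by rw [hM, Module.finrank_fin_fun])
  have hinj : LinearMap.ker (M.subtype ∘ₗ e.toLinearMap) = ⊥ :=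
    LinearMap.ker_eq_bot.2 (Subtype.val_injective.comp e.injective)
  obtain ⟨π, hπ⟩ := LinearMap.exists_leftInverse_of_injective _ hinj
  have hπ' : ∀ y, π (e y) = y := fun y => LinearMap.congr_fun hπ y
  refine ⟨M.subtype ∘ₗ e.toLinearMap, π, hπ', fun x => ⟨fun hx => ?_, fun hx => ?_⟩⟩
  · rw [← hx]
    exact (e _).2
  · obtain ⟨y, hy⟩ := e.surjective ⟨x, hx⟩
    have : x = e y := by rw [hy]
    rw [this, hπ']
    rfl

/-- A line as the zero locus of a linear form on a plane. -/
lemma exists_line_coordinates (hn : 3 ≤ n) {L : Submodule K (Fin n → K)}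
    (hL : Module.finrank K L = 2) :
    ∃ (ψ : (Fin 3 → K) →ₗ[K] (Fin n → K)) (π : (Fin n → K) →ₗ[K] (Fin 3 → K))
      (φ : Module.Dual K (Fin 3 → K)), φ ≠ 0 ∧ (∀ y, π (ψ y) = y) ∧
      ∀ x, (ψ (π x) = x ∧ φ (π x) = 0) ↔ x ∈ L := by
  obtain ⟨M, hLM, hM⟩ := exists_le_finrank_eq (k := 3) (hL.le.trans (by omega)) hn
  obtain ⟨ψ, π, hπ, hψ⟩ := exists_coordinates hM
  have hinj : Function.Injective ψ := fun a b hab => by rw [← hπ a, hab, hπ]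
  have hmap : (L.comap ψ).map ψ = L := by
    rw [Submodule.map_comap_eq, inf_eq_right]
    exact fun x hx => ⟨π x, (hψ x).2 (hLM hx)⟩
  have hr : Module.finrank K (L.comap ψ) = 2 := by
    rw [((L.comap ψ).equivMapOfInjective ψ hinj).finrank_eq, hmap, hL]
  obtain ⟨φ, hφ, hφL⟩ :=
    exists_dual_ne_zero_of_finrank_lt (show Module.finrank K (L.comap ψ) < 3 by omega)
  have hker : L.comap ψ = LinearMap.ker φ :=
    Submodule.eq_of_le_of_finrank_le hφL ((finrank_ker_dual_le_two hφ).trans hr.ge)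
  refine ⟨ψ, π, φ, hφ, hπ, fun x => ⟨fun ⟨h1, h2⟩ => ?_, fun hx => ?_⟩⟩
  · rw [← LinearMap.mem_ker, ← hker, Submodule.mem_comap, h1] at h2
    exact h2
  · have h1 := (hψ x).2 (hLM hx)
    exact ⟨h1, hφL _ (by rwa [Submodule.mem_comap, h1])⟩

/-- The points of a plane curve, given by a form `q` in plane coordinates. -/
def planeCurve (ψ : (Fin 3 → K) →ₗ[K] (Fin n → K)) (π : (Fin n → K) →ₗ[K] (Fin 3 → K))
    (q : MvPolynomial (Fin 3) K) : Set (Fin n → K) :=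
  {x | ψ (π x) = x ∧ eval (π x) q = 0}

lemma eval_zero_eq_zero {d : ℕ} {H : MvPolynomial (Fin n) K} (hH : H.IsHomogeneous d)
    (hd : 1 ≤ d) : eval 0 H = 0 := by
  rw [eval_zero]
  exact hH.coeff_eq_zero (by simp; omega)

/-- The part of a relation on one of two skew lines is a relation. -/
lemma IsRel.indicator_line {d : ℕ} {c : ι → K} (hd : 1 ≤ d) (h : IsRel d v c)
    {L₁ L₂ : Submodule K (Fin n → K)} (hdis : Disjoint L₁ L₂) (hcL : ∀ i, v i ∈ L₁ ∨ v i ∈ L₂) :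
    IsRel d v ({i | v i ∈ L₁}.indicator c) := by
  classical
  obtain ⟨N, hN, hNc⟩ := hdis.symm.exists_isCompl
  intro H hH
  rw [← h.map (Submodule.projection L₁ N hNc.symm) H hH]
  refine Finset.sum_congr rfl fun i _ => ?_
  by_cases hi : v i ∈ L₁
  · have hp := Submodule.projection_apply_left hNc.symm ⟨v i, hi⟩
    simp only at hp ⊢
    rw [Set.indicator_of_mem (by exact hi), hp]
  · have hp := Submodule.projection_apply_right hNc.symm ⟨v i, hN ((hcL i).resolve_left hi)⟩
    simp only at hp ⊢
    rw [Set.indicator_of_notMem (by exact hi), hp, zero_mul, eval_zero_eq_zero hH hd, mul_zero]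

/-- A relation of degree `d` between fewer than `3 * d` points restricts to a relation with many
points on a plane curve of degree at most two. -/
theorem IsRel.exists_planeCurve [Nonempty ι] (hn : 3 ≤ n) (hv : ProjInjective v) {d : ℕ}
    {c : ι → K} (h : IsRel d v c) (hc0 : ∀ i, c i ≠ 0) (hc : Fintype.card ι + 1 ≤ 3 * d) :
    ∃ (ψ : (Fin 3 → K) →ₗ[K] (Fin n → K)) (π : (Fin n → K) →ₗ[K] (Fin 3 → K)) (e : ℕ)
      (q : MvPolynomial (Fin 3) K), (∀ y, π (ψ y) = y) ∧ (e = 1 ∨ e = 2) ∧ q ≠ 0 ∧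
      q.IsHomogeneous e ∧ IsRel d v ((v ⁻¹' planeCurve ψ π q).indicator c) ∧
      e * d + 2 ≤ (coeffSupport ((v ⁻¹' planeCurve ψ π q).indicator c)).card := by
  classical
  have huniv : coeffSupport c = Finset.univ := by ext i; simp [hc0 i]
  have hmem : ∀ i, i ∈ coeffSupport c := fun i => by simp [hc0 i]
  have hcard : (coeffSupport c).card = Fintype.card ι := by rw [huniv, Finset.card_univ]
  rw [← hcard] at hc
  obtain ⟨k⟩ := ‹Nonempty ι›
  have hall : ∀ {s : Set (Fin n → K)}, (∀ i, v i ∈ s) → (v ⁻¹' s).indicator c = c := by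
    intro s hs
    rw [Set.indicator_eq_self]
    exact fun i _ => hs i
  by_cases hsmall : (coeffSupport c).card ≤ 2 * d + 1
  · obtain ⟨L₀, hL₀, hcL₀⟩ := h.exists_line hv hsmall
    obtain ⟨L, hL₀L, hL⟩ := exists_le_finrank_eq (k := 2) hL₀ (by omega)
    obtain ⟨ψ, π, φ, hφ, hπ, hmL⟩ := exists_line_coordinates hn hL
    have hD := hall (s := planeCurve ψ π (linForm φ)) fun i => by
      simpa only [planeCurve, Set.mem_ofPred_eq, eval_linForm, hmL] using hL₀L (hcL₀ i (hmem i))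
    refine ⟨ψ, π, 1, linForm φ, hπ, Or.inl rfl, linForm_ne_zero hφ, isHomogeneous_linForm φ, ?_⟩
    rw [hD, one_mul]
    exact ⟨h, h.add_two_le_card hv (hc0 k)⟩
  have hplane : ∀ M₀ : Submodule K (Fin n → K), Module.finrank K M₀ ≤ 3 → (∀ i, v i ∈ M₀) →
      ∃ (ψ : (Fin 3 → K) →ₗ[K] (Fin n → K)) (π : (Fin n → K) →ₗ[K] (Fin 3 → K)) (e : ℕ)
        (q : MvPolynomial (Fin 3) K), (∀ y, π (ψ y) = y) ∧ (e = 1 ∨ e = 2) ∧ q ≠ 0 ∧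
        q.IsHomogeneous e ∧ IsRel d v ((v ⁻¹' planeCurve ψ π q).indicator c) ∧
        e * d + 2 ≤ (coeffSupport ((v ⁻¹' planeCurve ψ π q).indicator c)).card := by
    intro M₀ hM₀ hvM₀
    obtain ⟨M, hM₀M, hM⟩ := exists_le_finrank_eq (k := 3) hM₀ hn
    obtain ⟨ψ, π, hπ, hψ⟩ := exists_coordinates hM
    have hψv : ∀ i, ψ (π (v i)) = v i := fun i => (hψ _).2 (hM₀M (hvM₀ i))
    have hv' : ProjInjective fun i => π (v i) := by
      refine ⟨fun i hi => hv.1 i ?_, fun i j hij hmem => hv.2 i j hij ?_⟩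
      · simp only at hi
        rw [← hψv i, hi, map_zero]
      · obtain ⟨θ, hθ⟩ := Submodule.mem_span_singleton.1 hmem
        refine Submodule.mem_span_singleton.2 ⟨θ, ?_⟩
        simp only at hθ
        rw [← hψv j, ← hθ, map_smul, hψv]
    obtain ⟨q, hq0, hq, hcq⟩ := (h.map π).exists_conic hv' hc
    have hD := hall (s := planeCurve ψ π q) fun i => ⟨hψv i, hcq i (hmem i)⟩
    refine ⟨ψ, π, 2, q, hπ, Or.inr rfl, hq0, hq, ?_⟩
    rw [hD]
    exact ⟨h, by omega⟩
  rcases h.exists_plane_or_two_lines hv hc with ⟨M, hM, hcM⟩ | ⟨L₁, L₂, hL₁, hL₂, hcL⟩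
  · exact hplane M hM fun i => hcM i (hmem i)
  wlog hk : v k ∈ L₁ generalizing L₁ L₂
  · exact this L₂ L₁ hL₂ hL₁ (fun i hi => (hcL i hi).symm)
      ((hcL k (hmem k)).resolve_left hk)
  by_cases hsup : Module.finrank K (L₁ ⊔ L₂ : Submodule K (Fin n → K)) ≤ 3
  · exact hplane _ hsup fun i => (hcL i (hmem i)).elim
      (fun hi => Submodule.mem_sup_left hi) fun hi => Submodule.mem_sup_right hi
  have hsum := Submodule.finrank_sup_add_finrank_inf_eq L₁ L₂
  have hdis : Disjoint L₁ L₂ := by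
    rw [disjoint_iff]
    exact Submodule.finrank_eq_zero.1 (by omega)
  obtain ⟨ψ, π, φ, hφ, hπ, hmL⟩ :=
    exists_line_coordinates hn (show Module.finrank K L₁ = 2 by omega)
  have hset : v ⁻¹' planeCurve ψ π (linForm φ) = {i | v i ∈ L₁} := by
    ext i
    simpa only [planeCurve, Set.mem_preimage, Set.mem_ofPred_eq, eval_linForm] using hmL (v i)
  refine ⟨ψ, π, 1, linForm φ, hπ, Or.inl rfl, linForm_ne_zero hφ, isHomogeneous_linForm φ, ?_⟩
  have hrel := h.indicator_line (by omega) hdis fun i => hcL i (hmem i)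
  rw [hset, one_mul]
  refine ⟨hrel, hrel.add_two_le_card hv (k := k) ?_⟩
  rw [Set.indicator_of_mem (by exact hk)]
  exact hc0 k

end Curve

section Powers

variable {K : Type*} [Field K] {n : ℕ}

/-- The linear form with coefficient vector `x`. -/
noncomputable def vecForm (x : Fin n → K) : MvPolynomial (Fin n) K := ∑ i, C (x i) * X i

lemma vecForm_smul (μ : K) (x : Fin n → K) : vecForm (μ • x) = C μ * vecForm x := by
  simp [vecForm, Finset.mul_sum, mul_assoc]

lemma vecForm_smul_pow (μ : K) (x : Fin n → K) (d : ℕ) :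
    vecForm (μ • x) ^ d = μ ^ d • vecForm x ^ d := by
  rw [vecForm_smul, mul_pow, ← C_pow, smul_eq_C_mul]

lemma coeff_vecForm_pow (x : Fin n → K) (m : Fin n →₀ ℕ) (d : ℕ) :
    coeff m (vecForm x ^ d) =
      if m.degree = d then m.multinomial * eval x (monomial m 1) else 0 := by
  have := coeff_linearCombination_X_pow_of_fintype x m d
  rw [show m.degree = m.sum fun _ k => k from rfl]
  simpa [vecForm, ← smul_eq_C_mul, eval_monomial] using this

lemma sum_smul_vecForm_pow_eq {ι ι' : Type*} {s : Finset ι} {s' : Finset ι'} {c : ι → K}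
    {c' : ι' → K} {v : ι → Fin n → K} {v' : ι' → Fin n → K} {d : ℕ}
    (h : ∀ H : MvPolynomial (Fin n) K, H.IsHomogeneous d →
      ∑ i ∈ s, c i * eval (v i) H = ∑ i ∈ s', c' i * eval (v' i) H) :
    ∑ i ∈ s, c i • vecForm (v i) ^ d = ∑ i ∈ s', c' i • vecForm (v' i) ^ d := by
  ext m
  simp only [coeff_sum, coeff_smul, coeff_vecForm_pow, smul_eq_mul]
  split_ifs with hm
  · have := h (monomial m 1) (isHomogeneous_monomial 1 hm)
    simp only [mul_left_comm _ (m.multinomial : K), ← Finset.mul_sum, this]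
  · simp

lemma isRel_of_sum_eq_zero [CharZero K] {ι : Type*} [Fintype ι] {c : ι → K} {v : ι → Fin n → K}
    {d : ℕ} (h : ∑ i, c i • vecForm (v i) ^ d = 0) : IsRel d v c := by
  have hmon : ∀ m : Fin n →₀ ℕ, m.degree = d → ∑ i, c i * eval (v i) (monomial m 1) = 0 := by
    intro m hm
    have := congrArg (coeff m) h
    simp only [coeff_sum, coeff_smul, coeff_vecForm_pow, smul_eq_mul, if_pos hm, coeff_zero,
      mul_left_comm _ (m.multinomial : K), ← Finset.mul_sum] at this
    refine (mul_eq_zero.1 this).resolve_left (Nat.cast_ne_zero.2 ?_)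
    rw [Finsupp.multinomial_eq]
    exact (Nat.multinomial_pos _ _).ne'
  intro H hH
  rw [H.as_sum]
  simp only [map_sum, Finset.mul_sum]
  rw [Finset.sum_comm]
  refine Finset.sum_eq_zero fun m hm => ?_
  have hdeg : m.degree = d := by
    by_contra hne
    exact mem_support_iff.1 hm (hH.coeff_eq_zero hne)
  have hsplit : monomial m (coeff m H) = C (coeff m H) * monomial m 1 := by
    rw [C_mul_monomial, mul_one]
  simp only [hsplit, map_mul, eval_C, mul_left_comm _ (coeff m H), ← Finset.mul_sum, hmon m hdeg,
    mul_zero]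

lemma eval_smul_of_isHomogeneous {q : MvPolynomial (Fin n) K} {e : ℕ} (hq : q.IsHomogeneous e)
    (μ : K) (x : Fin n → K) : eval (μ • x) q = μ ^ e * eval x q := by
  rw [eval_eq', eval_eq', Finset.mul_sum]
  refine Finset.sum_congr rfl fun m hm => ?_
  have hdeg : ∑ i, m i = e := by
    rw [← Finsupp.degree_eq_sum]
    by_contra hne
    exact mem_support_iff.1 hm (hq.coeff_eq_zero hne)
  simp only [Pi.smul_apply, smul_eq_mul, mul_pow, Finset.prod_mul_distrib,
    Finset.prod_pow_eq_pow_sum, hdeg]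
  ring

end Powers

section Decompositions

variable {K : Type} [Field K] {r d : ℕ} {f : MvPolynomial (Fin (r + 1)) K}

open Classical in
/-- The class of a nonzero vector. -/
noncomputable def projPoint (x : Fin (r + 1) → K) : Projectivization K (Fin (r + 1) → K) :=
  if h : x = 0 then Projectivization.mk K (Pi.single 0 1) (by simp) else Projectivization.mk K x h

lemma projPoint_rep (p : Projectivization K (Fin (r + 1) → K)) : projPoint p.rep = p := by
  rw [projPoint, dif_neg p.rep_nonzero, Projectivization.mk_rep]

lemma exists_smul_rep_projPoint (x : Fin (r + 1) → K) : ∃ μ : K, μ • (projPoint x).rep = x := by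
  by_cases hx : x = 0
  · exact ⟨0, by rw [hx, zero_smul]⟩
  · obtain ⟨a, ha⟩ := Projectivization.exists_smul_eq_mk_rep K x hx
    refine ⟨((a⁻¹ : Kˣ) : K), ?_⟩
    rw [projPoint, dif_neg hx, ← ha]
    exact inv_smul_smul a x

lemma powForm_eq (p : Projectivization K (Fin (r + 1) → K)) :
    powForm K r d p = vecForm p.rep ^ d := rfl

lemma vecForm_pow_mem {x : Fin (r + 1) → K} {S : Set (Projectivization K (Fin (r + 1) → K))}
    (hx : projPoint x ∈ S) : vecForm x ^ d ∈ decompSpan K r d S := by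
  obtain ⟨μ, hμ⟩ := exists_smul_rep_projPoint x
  rw [← hμ, vecForm_smul_pow]
  exact Submodule.smul_mem _ _ (Submodule.subset_span ⟨_, hx, rfl⟩)

lemma symRank_le {T : Finset (Projectivization K (Fin (r + 1) → K))}
    (hT : f ∈ decompSpan K r d ↑T) : symRank K r d f ≤ T.card :=
  Nat.sInf_le ⟨T, rfl, hT⟩

variable {ι : Type*} {s : Finset ι} {c : ι → K} {z : ι → Fin (r + 1) → K}

open Classical in
lemma mem_decompSpan_image (hf : f = ∑ i ∈ s, c i • vecForm (z i) ^ d) :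
    f ∈ decompSpan K r d ↑(s.image fun i => projPoint (z i)) := by
  rw [hf]
  refine Submodule.sum_mem _ fun i hi => Submodule.smul_mem _ _ (vecForm_pow_mem ?_)
  exact Finset.mem_coe.2 (Finset.mem_image_of_mem _ hi)

lemma symRank_le_of_eq_sum (hf : f = ∑ i ∈ s, c i • vecForm (z i) ^ d) :
    symRank K r d f ≤ s.card := by
  classical
  exact (symRank_le (mem_decompSpan_image hf)).trans Finset.card_image_le

lemma smul_vecForm_pow_ne_zero (hf : f = ∑ i ∈ s, c i • vecForm (z i) ^ d)
    (hs : s.card ≤ symRank K r d f) {i : ι} (hi : i ∈ s) : c i • vecForm (z i) ^ d ≠ 0 := by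
  classical
  intro h0
  rw [← Finset.add_sum_erase s _ hi, h0, zero_add] at hf
  have := symRank_le_of_eq_sum hf
  rw [Finset.card_erase_of_mem hi] at this
  have := Finset.card_pos.2 ⟨i, hi⟩
  omega

open Classical in
lemma image_mem_decompSet (hf : f = ∑ i ∈ s, c i • vecForm (z i) ^ d)
    (hs : s.card ≤ symRank K r d f) :
    (s.image fun i => projPoint (z i)) ∈ decompSet K r d f ∧
      Set.InjOn (fun i => projPoint (z i)) s := by
  have h1 := symRank_le (mem_decompSpan_image hf)
  have h2 : (s.image fun i => projPoint (z i)).card ≤ s.card := Finset.card_image_le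
  exact ⟨⟨mem_decompSpan_image hf, by omega⟩, Finset.card_image_iff.1 (by omega)⟩

lemma exists_coeff_of_mem_decompSpan {A : Finset (Projectivization K (Fin (r + 1) → K))}
    (hA : f ∈ decompSpan K r d ↑A) :
    ∃ a : Projectivization K (Fin (r + 1) → K) → K, (∀ p ∉ A, a p = 0) ∧
      f = ∑ p ∈ A, a p • vecForm p.rep ^ d := by
  classical
  obtain ⟨a, ha⟩ := (Submodule.mem_span_image_finset_iff_exists_fun' K).1 hA
  refine ⟨fun p => if p ∈ A then a p else 0, fun p hp => if_neg hp, ?_⟩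
  rw [← ha]
  exact Finset.sum_congr rfl fun p hp => by simp only [if_pos hp, powForm_eq]

/-- The coefficients of a decomposition are unique. -/
lemma coeff_unique {A : Finset (Projectivization K (Fin (r + 1) → K))}
    (hA : A ∈ decompSet K r d f) {a a' : Projectivization K (Fin (r + 1) → K) → K}
    (ha : f = ∑ p ∈ A, a p • vecForm p.rep ^ d) (ha' : f = ∑ p ∈ A, a' p • vecForm p.rep ^ d) :
    ∀ p ∈ A, a p = a' p := by
  intro p hp
  by_contra hne
  have hne' := sub_ne_zero.2 hne
  have h : f = ∑ x ∈ A, (a x - a p / (a p - a' p) * (a x - a' x)) • vecForm x.rep ^ d := by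
    simp only [sub_smul, mul_smul, Finset.sum_sub_distrib, ← Finset.smul_sum, ← ha, ← ha',
      sub_self, smul_zero, sub_zero]
  refine smul_vecForm_pow_ne_zero h hA.2.le hp ?_
  rw [div_mul_cancel₀ _ hne', sub_self, zero_smul]

/-- Only finitely many unweighted vectors represent the points of a given decomposition. -/
lemma finite_representatives (hd : 1 ≤ d) {B : Finset (Projectivization K (Fin (r + 1) → K))}
    (hB : B ∈ decompSet K r d f) : ∃ F : Set (Fin (r + 1) → K), F.Finite ∧
      ∀ (A : Finset (Projectivization K (Fin (r + 1) → K)))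
        (κ : Projectivization K (Fin (r + 1) → K) → K)
        (z : Projectivization K (Fin (r + 1) → K) → Fin (r + 1) → K),
        f = ∑ i ∈ A, κ i • vecForm (z i) ^ d → A.card ≤ symRank K r d f →
        (∀ b, b ∈ B ↔ ∃ i ∈ A, projPoint (z i) = b) → ∀ i ∈ A, κ i = 1 → z i ∈ F := by
  classical
  obtain ⟨β, -, hβ⟩ := exists_coeff_of_mem_decompSpan hB.1
  refine ⟨⋃ b ∈ B, (fun μ : K => μ • b.rep) '' {μ : K | μ ^ d = β b},
    B.finite_toSet.biUnion fun b _ => Set.Finite.image _ ?_, fun A κ z hf hA hAB i hi hκ => ?_⟩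
  · refine (Polynomial.nthRoots d (β b)).toFinset.finite_toSet.subset fun μ hμ => ?_
    exact Finset.mem_coe.2 (Multiset.mem_toFinset.2 ((Polynomial.mem_nthRoots hd).2 hμ))
  choose μ hμ using fun i => exists_smul_rep_projPoint (z i)
  have hγ : f = ∑ b ∈ B, (∑ i ∈ A with projPoint (z i) = b, κ i * μ i ^ d) • vecForm b.rep ^ d := by
    rw [hf, ← Finset.sum_fiberwise_of_maps_to fun i hi => (hAB _).2 ⟨i, hi, rfl⟩]
    refine Finset.sum_congr rfl fun b _ => ?_
    rw [Finset.sum_smul]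
    refine Finset.sum_congr rfl fun i hi => ?_
    rw [← (Finset.mem_filter.1 hi).2, mul_smul, ← vecForm_smul_pow, hμ]
  have hinj := (image_mem_decompSet hf hA).2
  have hbB := (hAB _).2 ⟨i, hi, rfl⟩
  have heq := coeff_unique hB hβ hγ _ hbB
  have hfil : (A.filter fun j => projPoint (z j) = projPoint (z i)) = {i} := by
    ext j
    simp only [Finset.mem_filter, Finset.mem_singleton]
    exact ⟨fun ⟨hj, hji⟩ => hinj hj hi hji, fun h => by rw [h]; exact ⟨hi, rfl⟩⟩
  rw [hfil, Finset.sum_singleton, hκ, one_mul] at heq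
  exact Set.mem_biUnion hbB ⟨μ i, heq.symm, hμ i⟩

end Decompositions

/-- Sufficiently many points on a plane curve of degree `e ≤ 2` move on the curve in an infinite
family with the same power sums of degree `d`. -/
lemma infinite_points_on_curve {K α : Type*} [Field K] [IsAlgClosed K] [Fintype α]
    {q : MvPolynomial (Fin 3) K} (hq : q ≠ 0) {e d : ℕ} (he : e = 1 ∨ e = 2)
    (hqe : q.IsHomogeneous e) (hd : 1 ≤ d) (hcard : e * d + 1 < 2 * Fintype.card α)
    (x₀ : α → Fin 3 → K) (h₀ : ∀ p, eval (x₀ p) q = 0) :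
    {x : α → Fin 3 → K | (∀ p, eval (x p) q = 0) ∧ ∀ H : MvPolynomial (Fin 3) K,
      H.IsHomogeneous d → ∑ p, eval (x p) H = ∑ p, eval (x₀ p) H}.Infinite := by
  obtain ⟨g, hg⟩ := exists_forms_modulo hq he hqe hd
  let G : α ⊕ Fin (e * d + 1) → MvPolynomial (α × Fin 3) K :=
    Sum.elim (fun p => rename (Prod.mk p) q)
      fun j => ∑ p, rename (Prod.mk p) (g j) - C (∑ p, eval (x₀ p) (g j))
  have hinf := infinite_zeros (by
    rw [Fintype.card_sum, Fintype.card_fin, Nat.card_eq_fintype_card, Fintype.card_prod,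
      Fintype.card_fin]
    omega) G (Function.uncurry x₀) (by
      rintro (p | j)
      · simp only [G, Sum.elim_inl, eval_rename]
        exact h₀ p
      · simp [G, eval_rename, Function.comp_def])
  refine (hinf.image (f := Function.curry) Function.curry_injective.injOn).mono ?_
  rintro _ ⟨x, hx, rfl⟩
  have hxq : ∀ p, eval (Function.curry x p) q = 0 := fun p => by
    have := hx (Sum.inl p)
    simp only [G, Sum.elim_inl, eval_rename] at this
    exact this
  refine ⟨hxq, fun H hH => ?_⟩
  obtain ⟨b, Q, rfl⟩ := hg H hH
  simp only [map_add, map_sum, map_mul, smul_eval, hxq, h₀, zero_mul, add_zero]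
  rw [Finset.sum_comm, Finset.sum_comm (s := Finset.univ (α := α))]
  refine Finset.sum_congr rfl fun j _ => ?_
  have := hx (Sum.inr j)
  simp only [G, Sum.elim_inr, map_sub, map_sum, eval_rename, eval_C, sub_eq_zero] at this
  rw [← Finset.mul_sum, ← Finset.mul_sum, ← this]
  rfl

lemma projInjective_rep {K : Type} [Field K] {r : ℕ}
    (W : Finset (Projectivization K (Fin (r + 1) → K))) : ProjInjective fun p : W => p.1.rep := by
  refine ⟨fun p => p.1.rep_nonzero, fun p p' hne hmem => hne (Subtype.ext ?_)⟩
  obtain ⟨θ, hθ⟩ := Submodule.mem_span_singleton.1 hmem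
  rw [← p.1.mk_rep, ← p'.1.mk_rep]
  exact ((Projectivization.mk_eq_mk_iff' K _ _ p'.1.rep_nonzero p.1.rep_nonzero).2 ⟨θ, hθ⟩).symm

/-- Two decompositions share many points of a plane curve of degree at most two. -/
lemma exists_planeCurve_card {K : Type} [Field K] [CharZero K] {r d : ℕ} (hr : 2 ≤ r)
    {f : MvPolynomial (Fin (r + 1)) K} (hsr : 2 * symRank K r d f < 3 * d)
    {A B : Finset (Projectivization K (Fin (r + 1) → K))} (hA : A ∈ decompSet K r d f)
    (hB : B ∈ decompSet K r d f) (hAB : A ≠ B) :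
    ∃ (ψ : (Fin 3 → K) →ₗ[K] (Fin (r + 1) → K)) (π : (Fin (r + 1) → K) →ₗ[K] (Fin 3 → K)) (e : ℕ)
      (q : MvPolynomial (Fin 3) K), (∀ y, π (ψ y) = y) ∧ (e = 1 ∨ e = 2) ∧ q ≠ 0 ∧
      q.IsHomogeneous e ∧ ∀ T : Finset (Projectivization K (Fin (r + 1) → K)),
        (∀ p, p ∈ T ↔ p ∈ A ∧ p.rep ∈ planeCurve ψ π q) → e * d + 2 ≤ 2 * T.card := by
  classical
  obtain ⟨a, ha0, ha⟩ := exists_coeff_of_mem_decompSpan hA.1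
  obtain ⟨b, hb0, hb⟩ := exists_coeff_of_mem_decompSpan hB.1
  set U := A ∪ B
  have haU : f = ∑ p ∈ U, a p • vecForm p.rep ^ d := by
    rw [ha]
    exact Finset.sum_subset Finset.subset_union_left fun p _ hp => by rw [ha0 p hp, zero_smul]
  have hbU : f = ∑ p ∈ U, b p • vecForm p.rep ^ d := by
    rw [hb]
    exact Finset.sum_subset Finset.subset_union_right fun p _ hp => by rw [hb0 p hp, zero_smul]
  set W := U.filter fun p => a p - b p ≠ 0
  have hWU : ∀ P : Projectivization K (Fin (r + 1) → K) → Prop,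
      ∑ p : W, (if P p then a p - b p else 0) • vecForm p.1.rep ^ d =
        ∑ p ∈ U with P p, (a p - b p) • vecForm p.rep ^ d := by
    intro P
    rw [Finset.sum_coe_sort W fun p => (if P p then a p - b p else 0) • vecForm p.rep ^ d,
      Finset.sum_filter, Finset.sum_filter]
    refine Finset.sum_congr rfl fun p _ => ?_
    by_cases h : a p - b p = 0
    · simp [h]
    · simp [h]
  obtain ⟨p₁, hp₁A, hp₁B⟩ : ∃ p ∈ A, p ∉ B := by
    by_contra! hsub
    exact hAB (Finset.eq_of_subset_of_card_le hsub (by rw [hA.2, hB.2]))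
  have hp₁ : p₁ ∈ W := by
    refine Finset.mem_filter.2 ⟨Finset.mem_union_left _ hp₁A, ?_⟩
    rw [hb0 p₁ hp₁B, sub_zero]
    exact left_ne_zero_of_smul (smul_vecForm_pow_ne_zero ha hA.2.le hp₁A)
  have : Nonempty W := ⟨⟨p₁, hp₁⟩⟩
  have hrel : IsRel d (fun p : W => p.1.rep) fun p => a p - b p := by
    refine isRel_of_sum_eq_zero ?_
    have := hWU fun _ => True
    simp only [if_true, Finset.filter_true, sub_smul, Finset.sum_sub_distrib] at this
    simp only [sub_smul, Finset.sum_sub_distrib]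
    rw [this, ← haU, ← hbU, sub_self]
  have hWcard : W.card ≤ A.card + B.card :=
    (Finset.card_filter_le _ _).trans (Finset.card_union_le _ _)
  rw [hA.2, hB.2] at hWcard
  obtain ⟨ψ, π, e, q, hπ, he, hq0, hq, hind, hcard⟩ := hrel.exists_planeCurve (by omega)
    (projInjective_rep W) (fun p => (Finset.mem_filter.1 p.2).2) (by
      rw [Fintype.card_coe]; omega)
  refine ⟨ψ, π, e, q, hπ, he, hq0, hq, fun T hT => ?_⟩
  set D : Projectivization K (Fin (r + 1) → K) → Prop := fun p => p.rep ∈ planeCurve ψ π q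
  have hsum : ∑ p ∈ U with D p, (a p - b p) • vecForm p.rep ^ d = 0 := by
    rw [← hWU]
    have := sum_smul_vecForm_pow_eq (s := Finset.univ) (s' := (∅ : Finset W)) (c' := 0)
      (v' := fun p : W => p.1.rep) (fun H hH => by
        rw [Finset.sum_empty]
        exact hind H hH)
    rw [Finset.sum_empty] at this
    rw [← this]
    rfl
  have hswap : f = ∑ p ∈ (B.filter fun p => ¬ D p) ∪ T,
      (if D p then a p else b p) • vecForm p.rep ^ d := by
    have hfil : ∀ (s : Finset (Projectivization K (Fin (r + 1) → K))) (k : _ → K), s ⊆ U →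
        (∀ p ∉ s, k p = 0) → ∑ p ∈ s with D p, k p • vecForm p.rep ^ d =
          ∑ p ∈ U with D p, k p • vecForm p.rep ^ d := fun s k hs hk =>
      Finset.sum_subset (Finset.filter_subset_filter _ hs) fun p hp hp' => by
        rw [hk p fun h => hp' (Finset.mem_filter.2 ⟨h, (Finset.mem_filter.1 hp).2⟩), zero_smul]
    have hTA : T = A.filter D := by
      ext p
      rw [hT, Finset.mem_filter]
    simp only [sub_smul, Finset.sum_sub_distrib, sub_eq_zero] at hsum
    rw [← hfil A a Finset.subset_union_left ha0, ← hfil B b Finset.subset_union_right hb0] at hsum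
    have hdisj : Disjoint (B.filter fun p => ¬ D p) T := Finset.disjoint_left.2 fun p hp hp' =>
      (Finset.mem_filter.1 hp).2 ((hT p).1 hp').2
    rw [Finset.sum_union hdisj, hTA,
      Finset.sum_congr rfl fun p hp => by rw [if_neg (Finset.mem_filter.1 hp).2],
      Finset.sum_congr (s₁ := A.filter D) rfl fun p hp => by
        rw [if_pos (Finset.mem_filter.1 hp).2], hsum]
    refine hb.trans ?_
    rw [add_comm (∑ p ∈ B with ¬ D p, _), Finset.sum_filter_add_sum_filter_not]
  have h1 := symRank_le_of_eq_sum hswap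
  have h2 := Finset.card_union_le (B.filter fun p => ¬ D p) T
  have h3 := Finset.card_filter_add_card_filter_not (s := B) D
  rw [hB.2] at h3
  have h4 : (coeffSupport (((fun p : W => p.1.rep) ⁻¹' planeCurve ψ π q).indicator
      fun p => a p - b p)).card ≤ (T ∪ B.filter D).card := by
    refine Finset.card_le_card_of_injOn Subtype.val (fun p hp => ?_) Subtype.val_injective.injOn
    have hpD : D p := by
      by_contra hpD
      exact mem_coeffSupport.1 hp (Set.indicator_of_notMem (by exact hpD) _)
    rcases Finset.mem_union.1 (Finset.mem_filter.1 p.2).1 with h | h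
    · exact Finset.mem_coe.2 (Finset.mem_union_left _ ((hT _).2 ⟨h, hpD⟩))
    · exact Finset.mem_coe.2 (Finset.mem_union_right _ (Finset.mem_filter.2 ⟨h, hpD⟩))
  have h5 := Finset.card_union_le T (B.filter D)
  omega

lemma pullbackForm_ne_zero_of_leftInverse {K : Type*} [Field K] [Infinite K] {m n : ℕ}
    {ψ : (Fin m → K) →ₗ[K] (Fin n → K)} {π : (Fin n → K) →ₗ[K] (Fin m → K)}
    (hπ : ∀ y, π (ψ y) = y) {q : MvPolynomial (Fin m) K} (hq : q ≠ 0) : pullbackForm π q ≠ 0 := by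
  intro h
  refine hq (MvPolynomial.funext fun y => ?_)
  rw [map_zero, ← hπ y, ← eval_pullbackForm, h, map_zero]

section Replace

variable {K : Type} [Field K] {r d : ℕ} {f : MvPolynomial (Fin (r + 1)) K}

open Classical in
/-- Move the points of `T` to prescribed points of a plane. -/
noncomputable def movePoints (T : Finset (Projectivization K (Fin (r + 1) → K)))
    (ψ : (Fin 3 → K) →ₗ[K] (Fin (r + 1) → K)) (x : T → Fin 3 → K)
    (p : Projectivization K (Fin (r + 1) → K)) : Fin (r + 1) → K :=
  if h : p ∈ T then ψ (x ⟨p, h⟩) else p.rep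

open Classical in
lemma eq_sum_movePoints {A T : Finset (Projectivization K (Fin (r + 1) → K))} (hTA : T ⊆ A)
    {a α : Projectivization K (Fin (r + 1) → K) → K} (ha : f = ∑ p ∈ A, a p • vecForm p.rep ^ d)
    (hα : ∀ p, α p ^ d = a p) {ψ : (Fin 3 → K) →ₗ[K] (Fin (r + 1) → K)}
    {x₀ x : T → Fin 3 → K} (hx₀ : ∀ p, ψ (x₀ p) = α p.1 • p.1.rep)
    (hx : ∀ H : MvPolynomial (Fin 3) K, H.IsHomogeneous d →
      ∑ p, eval (x p) H = ∑ p, eval (x₀ p) H) :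
    f = ∑ p ∈ A, (if p ∈ T then 1 else a p) • vecForm (movePoints T ψ x p) ^ d := by
  have hmove : ∑ p : T, (1 : K) • vecForm (ψ (x p)) ^ d =
      ∑ p : T, (1 : K) • vecForm (ψ (x₀ p)) ^ d :=
    sum_smul_vecForm_pow_eq fun H hH => by
      simpa using hx _ (isHomogeneous_pullbackForm hH ψ)
  have hT : ∑ p ∈ T, (if p ∈ T then 1 else a p) • vecForm (movePoints T ψ x p) ^ d =
      ∑ p ∈ T, a p • vecForm p.rep ^ d := by
    rw [← Finset.sum_coe_sort T, ← Finset.sum_coe_sort T]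
    convert hmove using 2 with p _ p _
    · simp [movePoints]
    · rw [hx₀, vecForm_smul_pow, hα, one_smul]
  rw [ha, ← Finset.sum_sdiff hTA, ← Finset.sum_sdiff hTA, hT]
  congr 1
  refine Finset.sum_congr rfl fun p hp => ?_
  have hpT := (Finset.mem_sdiff.1 hp).2
  rw [if_neg hpT, movePoints, dif_neg hpT]

end Replace

/-- under the hypotheses of Theorem 1.2, every `A ∈ S(f)` has an
associated hypersurface `Z(q)` of degree at most `2` such that infinitely many
decompositions `B ∈ S(f)` agree with `A` off `Z(q)`. -/
theorem stmt_1 {K : Type} [Field K] [IsAlgClosed K] [CharZero K]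
    {r d t : ℕ} (hr : 2 ≤ r) (hd : 1 ≤ d) (ht : 0 < t) (htd : 2 * t < 3 * d)
    {f : MvPolynomial (Fin (r + 1)) K} (hf0 : f ≠ 0) (hfh : f.IsHomogeneous d)
    (hsr : symRank K r d f = t)
    {A₀ B₀ : Finset (Projectivization K (Fin (r + 1) → K))}
    (hA₀ : A₀ ∈ decompSet K r d f) (hB₀ : B₀ ∈ decompSet K r d f) (hAB₀ : A₀ ≠ B₀) :
    ∀ A ∈ decompSet K r d f,
      ∃ q : MvPolynomial (Fin (r + 1)) K, q ≠ 0 ∧ (∃ e ≤ 2, q.IsHomogeneous e) ∧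
        {B | B ∈ decompSet K r d f ∧
          (∀ p ∈ A, p ∉ projZeros K r q → p ∈ B) ∧
          (∀ p ∈ B, p ∉ A → p ∈ projZeros K r q)}.Infinite := by
  classical
  intro A hA
  obtain ⟨B, hB, hAB⟩ : ∃ B ∈ decompSet K r d f, A ≠ B := by
    by_cases h : A = A₀
    · exact ⟨B₀, hB₀, h ▸ hAB₀⟩
    · exact ⟨A₀, hA₀, h⟩
  obtain ⟨ψ, π, e, q, hπ, he, hq0, hq, hcard⟩ :=
    exists_planeCurve_card hr (hsr.symm ▸ htd) hA hB hAB
  obtain ⟨a, -, ha⟩ := exists_coeff_of_mem_decompSpan hA.1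
  choose α hα using fun p => IsAlgClosed.exists_pow_nat_eq (a p) hd
  set T := A.filter fun p => p.rep ∈ planeCurve ψ π q
  have hTA : T ⊆ A := Finset.filter_subset _ _
  have hT : ∀ p : T, p.1.rep ∈ planeCurve ψ π q := fun p => (Finset.mem_filter.1 p.2).2
  have hX := infinite_points_on_curve (α := T) hq0 he hq hd
    (by rw [Fintype.card_coe]; have := hcard T fun p => Finset.mem_filter; omega)
    (fun p => π (α p.1 • p.1.rep))
    (fun p => by rw [map_smul, eval_smul_of_isHomogeneous hq, (hT p).2, mul_zero])
  set X := {x : T → Fin 3 → K | _}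
  have hsum : ∀ x ∈ X, _ := fun x hx => eq_sum_movePoints hTA ha hα
    (fun p => by rw [map_smul, map_smul, (hT p).1]) hx.2
  refine ⟨pullbackForm π q, pullbackForm_ne_zero_of_leftInverse hπ hq0,
    ⟨e, by omega, isHomogeneous_pullbackForm hq π⟩, fun hfin => hX ?_⟩
  refine Set.Finite.of_finite_fibers
    (fun x => A.image fun p => projPoint (movePoints T ψ x p)) (hfin.subset ?_) fun B' hB' => ?_
  · rintro _ ⟨x, hx, rfl⟩
    refine ⟨(image_mem_decompSet (hsum x hx) hA.2.le).1, fun p hp hpq => ?_, fun b hb hbA => ?_⟩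
    · have hpT : p ∉ T := fun h => hpq ((eval_pullbackForm π q p.rep).trans (hT ⟨p, h⟩).2)
      refine Finset.mem_image.2 ⟨p, hp, ?_⟩
      rw [movePoints, dif_neg hpT, projPoint_rep]
    · obtain ⟨p, hp, rfl⟩ := Finset.mem_image.1 hb
      have hpT : p ∈ T := by
        by_contra hpT
        rw [movePoints, dif_neg hpT, projPoint_rep] at hbA
        exact hbA hp
      have hz := right_ne_zero_of_smul (smul_vecForm_pow_ne_zero (hsum x hx) hA.2.le hp)
      obtain ⟨μ, hμ⟩ := exists_smul_rep_projPoint (movePoints T ψ x p)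
      have hμ0 : μ ≠ 0 := by
        rintro rfl
        rw [← hμ, vecForm_smul_pow, zero_pow (by omega), zero_smul] at hz
        exact hz rfl
      have h0 : eval (π (movePoints T ψ x p)) q = 0 := by
        rw [movePoints, dif_pos hpT, hπ]
        exact hx.1 _
      rw [← hμ, map_smul, eval_smul_of_isHomogeneous hq] at h0
      exact (eval_pullbackForm π q _).trans ((mul_eq_zero.1 h0).resolve_left (pow_ne_zero _ hμ0))
  · obtain ⟨x₁, hx₁, rfl⟩ := hB'
    obtain ⟨F, hF, hrep⟩ := finite_representatives hd
      (image_mem_decompSet (hsum x₁ hx₁) hA.2.le).1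
    refine (Set.Finite.pi' fun _ : T => hF.image π).subset fun x hx p => ?_
    have himage : A.image (fun p => projPoint (movePoints T ψ x p)) =
        A.image fun p => projPoint (movePoints T ψ x₁ p) := hx.2
    have := hrep A _ _ (hsum x hx.1) hA.2.le (fun b => by
      rw [← himage]
      exact Finset.mem_image) p.1 (hTA p.2) (if_pos p.2)
    rw [movePoints, dif_pos p.2] at this
    exact ⟨_, this, hπ _⟩
end

section
/- Fix positive integers r, d, t with t ≤ d, a nonzero homogeneous polynomial q of degree t in y_0,…,y_r, and finite sets A, B of points of ℙ^r (given by pairwise non-proportional nonzero linear forms). Assume that the family of (d−t)-th powers (ℓ^{d−t}), taken over one representative per point of (A ∪ B) ∖ Z(q), is linearly independent over K. Set F := (A ∩ B) ∖ Z(q), the set of common points of A and B not lying on Z(q). Then the family (ℓ^d) over the points of F is linearly independent, and span{ℓ^d : [ℓ] ∈ A} ∩ span{ℓ^d : [ℓ] ∈ B} is the internal direct sum of span{ℓ^d : [ℓ] ∈ F} and span{ℓ^d : [ℓ] ∈ A ∩ Z(q)} ∩ span{ℓ^d : [ℓ] ∈ B ∩ Z(q)}. -/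
open MvPolynomial

/-- Iterated partial differentiation of powers of linear forms along a multiset of variables. -/
theorem exists_linearMap_linearForm_pow {σ R : Type*} [Fintype σ] [CommRing R]
    (s : Multiset σ) :
    ∃ D : MvPolynomial σ R →ₗ[R] MvPolynomial σ R, ∀ (a : σ → R) (d : ℕ),
      D ((∑ i, C (a i) * X i) ^ d) =
        ((d.descFactorial s.card : R) * (s.map a).prod) •
          (∑ i, C (a i) * X i) ^ (d - s.card) := by
  classical
  induction s using Multiset.induction_on with
  | empty => exact ⟨LinearMap.id, fun a d => by simp⟩
  | cons j s ih =>
    obtain ⟨D, hD⟩ := ih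
    refine ⟨(pderiv j).toLinearMap ∘ₗ D, fun a d => ?_⟩
    have hj : pderiv j (∑ i, C (a i) * X i : MvPolynomial σ R) = C (a j) := by
      simp [Derivation.leibniz, pderiv_X, Pi.single_apply]
    rw [LinearMap.comp_apply, hD, map_smul, Derivation.coeFn_coe, Derivation.leibniz_pow, hj, Multiset.card_cons,
      Nat.descFactorial_succ, Multiset.map_cons, Multiset.prod_cons, Nat.sub_sub]
    simp only [smul_eq_mul, nsmul_eq_mul, smul_eq_C_mul, map_mul, Nat.cast_mul, map_natCast]
    ring

/-- The differential operator `q(∂)` maps `ℓ ^ d` to a multiple of `q(ℓ) • ℓ ^ (d - t)`. -/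
theorem MvPolynomial.IsHomogeneous.exists_linearMap_linearForm_pow {σ R : Type*} [Fintype σ]
    [CommRing R] {q : MvPolynomial σ R} {t : ℕ} (hq : q.IsHomogeneous t) :
    ∃ D : MvPolynomial σ R →ₗ[R] MvPolynomial σ R, ∀ (a : σ → R) (d : ℕ),
      D ((∑ i, C (a i) * X i) ^ d) =
        ((d.descFactorial t : R) * eval a q) • (∑ i, C (a i) * X i) ^ (d - t) := by
  classical
  choose D hD using fun m : σ →₀ ℕ =>
    _root_.exists_linearMap_linearForm_pow (R := R) (Finsupp.toMultiset m)
  refine ⟨∑ m ∈ q.support, coeff m q • D m, fun a d => ?_⟩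
  rw [eval_eq, Finset.mul_sum, Finset.sum_smul, LinearMap.sum_apply]
  refine Finset.sum_congr rfl fun m hm => ?_
  have hcard : (Finsupp.toMultiset m).card = t := by
    rw [Finsupp.card_toMultiset]
    simpa [Finsupp.weight_apply, Finsupp.sum] using hq (mem_support_iff.mp hm)
  have hprod : ((Finsupp.toMultiset m).map a).prod = ∏ i ∈ m.support, a i ^ m i := by
    rw [Finsupp.toMultiset_map, Finsupp.prod_toMultiset,
      Finsupp.prod_mapDomain_index (fun _ => pow_zero _) fun _ _ _ => pow_add _ _ _]
    rfl
  rw [LinearMap.smul_apply, hD, hcard, hprod, smul_smul]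
  congr 1
  ring

/-- If `D` kills `v` on `Z` and `D ∘ v` is linearly independent on `(A ∪ B) \ Z`, then the
intersection of the spans of `v '' A` and `v '' B` splits along `Z`. -/
theorem span_image_inf_span_image_of_linearIndepOn {ι R M N : Type*} [Ring R] [AddCommGroup M]
    [Module R M] [AddCommGroup N] [Module R N] (v : ι → M) (D : M →ₗ[R] N) {A B Z : Set ι}
    (hZ : ∀ p ∈ Z, D (v p) = 0) (hind : LinearIndepOn R (D ∘ v) ((A ∪ B) \ Z)) :
    LinearIndepOn R v ((A ∩ B) \ Z) ∧
      Disjoint (Submodule.span R (v '' ((A ∩ B) \ Z)))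
        (Submodule.span R (v '' (A ∩ Z)) ⊓ Submodule.span R (v '' (B ∩ Z))) ∧
      Submodule.span R (v '' ((A ∩ B) \ Z)) ⊔
          (Submodule.span R (v '' (A ∩ Z)) ⊓ Submodule.span R (v '' (B ∩ Z))) =
        Submodule.span R (v '' A) ⊓ Submodule.span R (v '' B) := by
  have hv : LinearIndepOn R v ((A ∪ B) \ Z) := LinearIndependent.of_comp D hind
  have hFU : (A ∩ B) \ Z ⊆ (A ∪ B) \ Z :=
    Set.sdiff_subset_sdiff_left (Set.inter_subset_left.trans Set.subset_union_left)
  have hker : Disjoint (Submodule.span R (v '' ((A ∪ B) \ Z))) (LinearMap.ker D) := by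
    rw [Set.image_eq_range]
    exact Submodule.range_ker_disjoint hind
  have hZker (S : Set ι) : Submodule.span R (v '' (S ∩ Z)) ≤ LinearMap.ker D := by
    rw [Submodule.span_le]
    rintro _ ⟨p, hp, rfl⟩
    exact hZ p hp.2
  have mono {S T : Set ι} (h : S ⊆ T) : Submodule.span R (v '' S) ≤ Submodule.span R (v '' T) :=
    Submodule.span_mono (Set.image_mono h)
  have hsplit (S : Set ι) : Submodule.span R (v '' S) =
      Submodule.span R (v '' (S \ Z)) ⊔ Submodule.span R (v '' (S ∩ Z)) := by
    rw [← Submodule.span_union, ← Set.image_union, Set.sdiff_union_inter]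
  refine ⟨hv.mono hFU, hker.mono (mono hFU) (inf_le_left.trans (hZker A)), le_antisymm ?_ ?_⟩
  · refine sup_le (le_inf (mono ?_) (mono ?_))
      (inf_le_inf (mono Set.inter_subset_left) (mono Set.inter_subset_left))
    · exact Set.sdiff_subset.trans Set.inter_subset_left
    · exact Set.sdiff_subset.trans Set.inter_subset_right
  · rintro x ⟨hxA, hxB⟩
    rw [SetLike.mem_coe, hsplit, Submodule.mem_sup] at hxA hxB
    obtain ⟨a, ha, a', ha', rfl⟩ := hxA
    obtain ⟨b, hb, b', hb', hab⟩ := hxB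
    have hDa : D a' = 0 := hZker A ha'
    have hDb : D b' = 0 := hZker B hb'
    have hsub : a - b = 0 := by
      refine Submodule.disjoint_def.mp hker _ (sub_mem ?_ ?_) ?_
      · exact mono (Set.sdiff_subset_sdiff_left Set.subset_union_left) ha
      · exact mono (Set.sdiff_subset_sdiff_left Set.subset_union_right) hb
      · have := congrArg D hab
        rw [map_add, map_add, hDa, hDb, add_zero, add_zero] at this
        rw [LinearMap.mem_ker, map_sub, this, sub_self]
    obtain rfl : a = b := sub_eq_zero.mp hsub
    obtain rfl : b' = a' := add_left_cancel hab
    refine Submodule.add_mem_sup ?_ ⟨ha', hb'⟩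
    rw [Finsupp.mem_span_image_iff_linearCombination] at ha hb
    obtain ⟨l, hl, hla⟩ := ha
    obtain ⟨l', hl', rfl⟩ := hb
    have hl_eq : l = l' := by
      refine sub_eq_zero.mp (linearIndepOn_iff.mp hv _ (sub_mem ?_ ?_) ?_)
      · exact Finsupp.supported_mono (Set.sdiff_subset_sdiff_left Set.subset_union_left) hl
      · exact Finsupp.supported_mono (Set.sdiff_subset_sdiff_left Set.subset_union_right) hl'
      · rw [map_sub, hla, sub_self]
    subst hl_eq
    rw [Finsupp.mem_span_image_iff_linearCombination]
    exact ⟨l, fun p hp => ⟨⟨(hl hp).1, (hl' hp).1⟩, (hl hp).2⟩, rfl⟩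

/-- Lemma 3.2, first part: with `Z(q)` a degree-`t` hypersurface and
the `(d-t)`-th powers of the points of `(A ∪ B) \ Z(q)` linearly independent, the
`d`-th powers of the points of `F := (A ∩ B) \ Z(q)` are linearly independent, and
`span{ℓ^d : A} ⊓ span{ℓ^d : B}` is the internal direct sum of `span{ℓ^d : F}` and
`span{ℓ^d : A ∩ Z(q)} ⊓ span{ℓ^d : B ∩ Z(q)}`. -/
theorem stmt_3 {K : Type} [Field K] [IsAlgClosed K] [CharZero K]
    {r d t : ℕ} (hr : 0 < r) (hd : 0 < d) (ht : 0 < t) (htd : t ≤ d)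
    {q : MvPolynomial (Fin (r + 1)) K} (hq0 : q ≠ 0) (hqh : q.IsHomogeneous t)
    (A B : Finset (Projectivization K (Fin (r + 1) → K)))
    (hind : LinearIndependent K
      (fun p : (((↑A ∪ ↑B : Set (Projectivization K (Fin (r + 1) → K)))
          \ projZeros K r q : Set _)) => powForm K r (d - t) ↑p)) :
    LinearIndependent K
      (fun p : (((↑A ∩ ↑B : Set (Projectivization K (Fin (r + 1) → K)))
          \ projZeros K r q : Set _)) => powForm K r d ↑p)
    ∧ Disjoint
        (decompSpan K r d ((↑A ∩ ↑B : Set _) \ projZeros K r q))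
        (decompSpan K r d ((↑A : Set _) ∩ projZeros K r q)
          ⊓ decompSpan K r d ((↑B : Set _) ∩ projZeros K r q))
    ∧ decompSpan K r d ((↑A ∩ ↑B : Set _) \ projZeros K r q)
        ⊔ (decompSpan K r d ((↑A : Set _) ∩ projZeros K r q)
          ⊓ decompSpan K r d ((↑B : Set _) ∩ projZeros K r q))
      = decompSpan K r d ↑A ⊓ decompSpan K r d ↑B := by
  obtain ⟨D, hD⟩ := hqh.exists_linearMap_linearForm_pow
  have hDp (p : Projectivization K (Fin (r + 1) → K)) : D (powForm K r d p) =
      ((d.descFactorial t : K) * eval p.rep q) • powForm K r (d - t) p := hD p.rep d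
  have hdt : (d.descFactorial t : K) ≠ 0 := by
    rw [Nat.cast_ne_zero]
    exact (Nat.descFactorial_pos.mpr htd).ne'
  refine span_image_inf_span_image_of_linearIndepOn (powForm K r d) D (fun p hp => ?_) ?_
  · rw [hDp, show eval p.rep q = 0 from hp, mul_zero, zero_smul]
  · have h := hind.units_smul fun p =>
      Units.mk0 ((d.descFactorial t : K) * eval p.1.rep q) (mul_ne_zero hdt p.2.2)
    simp only [LinearIndepOn, Function.comp_apply, hDp]
    exact h
end

section
/- Fix positive integers r, d, t with t ≤ d, a nonzero homogeneous polynomial q of degree t in y_0,…,y_r, and finite sets A, B of points of ℙ^r (given by pairwise non-proportional nonzero linear forms). Assume that the family of (d−t)-th powers (ℓ^{d−t}), taken over one representative per point of (A ∪ B) ∖ Z(q), is linearly independent over K. Assume moreover there is a nonzero homogeneous polynomial f of degree d with f ∈ span{ℓ^d : [ℓ] ∈ A} ∩ span{ℓ^d : [ℓ] ∈ B}, f ∉ span{ℓ^d : [ℓ] ∈ A'} for every proper subset A' ⊊ A, and f ∉ span{ℓ^d : [ℓ] ∈ B'} for every proper subset B' ⊊ B. Then, as sets of points of ℙ^r, A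 ∖ Z(q) = B ∖ Z(q); that is, A is the disjoint union of A ∩ Z(q) and F, B is the disjoint union of B ∩ Z(q) and F, where F := (A ∩ B) ∖ Z(q). -/
open MvPolynomial

/-- A monomial acts on powers of linear forms as a constant coefficient differential operator. -/
theorem exists_linearMap_monomial_apply_pow {K σ : Type*} [Field K] [Fintype σ]
    (s : σ →₀ ℕ) :
    ∃ T : MvPolynomial σ K →ₗ[K] MvPolynomial σ K, ∀ (v : σ → K) (n : ℕ),
      T ((∑ i, C (v i) * X i) ^ n) =
        ((n.descFactorial s.degree : K) * s.prod fun i k => v i ^ k) •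
          (∑ i, C (v i) * X i) ^ (n - s.degree) := by
  classical
  induction s using Finsupp.induction_linear with
  | zero => exact ⟨LinearMap.id, fun v n => by simp⟩
  | add s u hs hu =>
    obtain ⟨S, hS⟩ := hs
    obtain ⟨U, hU⟩ := hu
    refine ⟨U ∘ₗ S, fun v n => ?_⟩
    rw [LinearMap.comp_apply, hS, map_smul, hU, smul_smul, map_add, Nat.sub_sub,
      ← Nat.descFactorial_mul_descFactorial (Nat.le_add_right s.degree u.degree),
      Nat.add_sub_cancel_left, Nat.cast_mul,
      Finsupp.prod_add_index' (fun _ => pow_zero _) (fun _ _ _ => pow_add _ _ _)]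
    congr 1
    ring
  | single i k =>
    induction k with
    | zero => exact ⟨LinearMap.id, fun v n => by simp⟩
    | succ k ih =>
      obtain ⟨S, hS⟩ := ih
      refine ⟨(pderiv i).toLinearMap ∘ₗ S, fun v n => ?_⟩
      have hl : pderiv i (∑ j, C (v j) * X j : MvPolynomial σ K) = C (v i) := by
        simp [pderiv_X, Pi.single_apply]
      have hS' := hS v n
      simp only [Finsupp.degree_single, Finsupp.prod_single_index, pow_zero] at hS' ⊢
      rw [LinearMap.comp_apply, hS', map_smul, Derivation.coeFn_coe, Derivation.leibniz_pow, hl, Nat.sub_sub, Nat.descFactorial_succ]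
      simp only [smul_eq_C_mul, smul_eq_mul, nsmul_eq_mul, Nat.cast_mul, C_mul, pow_succ,
        map_natCast]
      ring

/-- A homogeneous polynomial `q` of degree `t` acts on powers of linear forms as a differential
operator of order `t`. -/
theorem MvPolynomial.IsHomogeneous.exists_linearMap_apply_pow {K σ : Type*} [Field K] [Fintype σ]
    {q : MvPolynomial σ K} {t : ℕ} (hq : q.IsHomogeneous t) :
    ∃ T : MvPolynomial σ K →ₗ[K] MvPolynomial σ K, ∀ (v : σ → K) (n : ℕ),
      T ((∑ i, C (v i) * X i) ^ n) =
        ((n.descFactorial t : K) * eval v q) • (∑ i, C (v i) * X i) ^ (n - t) := by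
  choose T hT using exists_linearMap_monomial_apply_pow (K := K) (σ := σ)
  refine ⟨∑ s ∈ q.support, coeff s q • T s, fun v n => ?_⟩
  rw [eval_eq, Finset.mul_sum, Finset.sum_smul, LinearMap.sum_apply]
  refine Finset.sum_congr rfl fun s hs => ?_
  have hdeg : s.degree = t := by
    rw [Finsupp.degree_eq_weight_one]
    exact hq (mem_support_iff.mp hs)
  rw [LinearMap.smul_apply, hT, hdeg, smul_smul, Finsupp.prod]
  congr 1
  ring

/-- If `f` lies minimally in the span of the `d`-th powers of `A`, it is a combination of the
`d`-th powers whose coefficients have support exactly `A`. -/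
theorem exists_coeff_of_minimal {K : Type} [Field K] {r d : ℕ}
    {A U : Finset (Projectivization K (Fin (r + 1) → K))} (hAU : A ⊆ U)
    {f : MvPolynomial (Fin (r + 1)) K} (hfA : f ∈ decompSpan K r d ↑A)
    (hminA : ∀ A' : Finset (Projectivization K (Fin (r + 1) → K)),
      A' ⊂ A → f ∉ decompSpan K r d ↑A') :
    ∃ a : Projectivization K (Fin (r + 1) → K) → K,
      (∀ p, a p ≠ 0 ↔ p ∈ A) ∧ ∑ p ∈ U, a p • powForm K r d p = f := by
  classical
  obtain ⟨a, ha⟩ := (Submodule.mem_span_image_finset_iff_exists_fun' K).mp hfA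
  refine ⟨fun p => if p ∈ A then a p else 0, fun p => ?_, ?_⟩
  · by_cases hp : p ∈ A
    · simp only [hp, if_true, iff_true]
      intro h0
      refine hminA _ (Finset.erase_ssubset hp)
        ((Submodule.mem_span_image_finset_iff_exists_fun' K).mpr ⟨a, ?_⟩)
      rw [← ha, ← Finset.add_sum_erase A _ hp, h0, zero_smul, zero_add]
    · simp [hp]
  · simp only [ite_smul, zero_smul]
    rw [← Finset.sum_filter, Finset.filter_mem_eq_inter, Finset.inter_eq_right.mpr hAU, ha]

/-- Lemma 3.2, second part: under the hypotheses of Statement 3, if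
moreover `f` lies minimally in the spans of the `d`-th powers of `A` and of `B`,
then `A` and `B` agree off `Z(q)`. -/
theorem stmt_4 {K : Type} [Field K] [IsAlgClosed K] [CharZero K]
    {r d t : ℕ} (hr : 0 < r) (hd : 0 < d) (ht : 0 < t) (htd : t ≤ d)
    {q : MvPolynomial (Fin (r + 1)) K} (hq0 : q ≠ 0) (hqh : q.IsHomogeneous t)
    (A B : Finset (Projectivization K (Fin (r + 1) → K)))
    (hind : LinearIndependent K
      (fun p : (((↑A ∪ ↑B : Set (Projectivization K (Fin (r + 1) → K)))
          \ projZeros K r q : Set _)) => powForm K r (d - t) ↑p))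
    {f : MvPolynomial (Fin (r + 1)) K} (hf0 : f ≠ 0) (hfh : f.IsHomogeneous d)
    (hfA : f ∈ decompSpan K r d ↑A) (hfB : f ∈ decompSpan K r d ↑B)
    (hminA : ∀ A' : Finset (Projectivization K (Fin (r + 1) → K)),
      A' ⊂ A → f ∉ decompSpan K r d ↑A')
    (hminB : ∀ B' : Finset (Projectivization K (Fin (r + 1) → K)),
      B' ⊂ B → f ∉ decompSpan K r d ↑B') :
    (↑A : Set (Projectivization K (Fin (r + 1) → K))) \ projZeros K r q
      = ↑B \ projZeros K r q := by
  classical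
  obtain ⟨a, ha, hfa⟩ := exists_coeff_of_minimal (Finset.subset_union_left (s₂ := B)) hfA hminA
  obtain ⟨b, hb, hfb⟩ := exists_coeff_of_minimal (Finset.subset_union_right (s₁ := A)) hfB hminB
  obtain ⟨T, hT⟩ := hqh.exists_linearMap_apply_pow
  have hc : (d.descFactorial t : K) ≠ 0 :=
    Nat.cast_ne_zero.mpr (Nat.descFactorial_eq_zero_iff_lt.not.mpr htd.not_gt)
  set g : Projectivization K (Fin (r + 1) → K) → K :=
    fun p => (a p - b p) * ((d.descFactorial t : K) * eval p.rep q) with hg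
  have hsum : ∑ p ∈ A ∪ B, g p • powForm K r (d - t) p = 0 := by
    have h : T (∑ p ∈ A ∪ B, (a p - b p) • powForm K r d p) = 0 := by
      simp only [sub_smul, Finset.sum_sub_distrib, hfa, hfb, sub_self, map_zero]
    rw [map_sum] at h
    rw [← h]
    refine Finset.sum_congr rfl fun p _ => ?_
    rw [map_smul, powForm, powForm, hT, smul_smul]
  have hsum' : ∑ p ∈ A ∪ B with p ∉ projZeros K r q, g p • powForm K r (d - t) p = 0 := by
    rw [← hsum, Finset.sum_filter_of_ne]
    intro p _ hp hpZ
    have hz : eval p.rep q = 0 := hpZ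
    exact hp (by simp [hg, hz])
  have hind' : LinearIndepOn K (powForm K r (d - t))
      ((↑A ∪ ↑B : Set (Projectivization K (Fin (r + 1) → K))) \ projZeros K r q) := hind
  have hab : ∀ p ∈ A ∪ B, p ∉ projZeros K r q → a p = b p := by
    intro p hp hpZ
    have h0 := linearIndepOn_iff'.mp hind' _ g (fun x hx => by simpa using hx) hsum' p
      (Finset.mem_filter.mpr ⟨hp, hpZ⟩)
    have hz : eval p.rep q ≠ 0 := hpZ
    exact sub_eq_zero.mp ((mul_eq_zero.mp h0).resolve_right (mul_ne_zero hc hz))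
  ext p
  simp only [Set.mem_sdiff, Finset.mem_coe]
  refine and_congr_left fun hpZ => ⟨fun hp => ?_, fun hp => ?_⟩
  · rw [← hb, ← hab p (Finset.mem_union_left _ hp) hpZ, ha]
    exact hp
  · rw [← ha, hab p (Finset.mem_union_right _ hp) hpZ, hb]
    exact hp
end

section
/- Let r = 1 and let f be a nonzero homogeneous polynomial of degree d in x_0, x_1 over K (a binary form). If f admits two decompositions that are not identified (i.e., two subsets of ℙ^1 of cardinality sr(f) both computing sr(f)), then S(f) is infinite: there are infinitely many pairwise non-identified decompositions of f. -/
open MvPolynomial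

/-- The affine chart `a ↦ [a : 1 + m a]` of `ℙ^1`, which omits only the point `[1 : m]`. -/
noncomputable def affineChart {K : Type} [Field K] (m a : K) :
    Projectivization K (Fin (1 + 1) → K) :=
  Projectivization.mk K ![a, 1 + m * a] (by
    intro h
    have h0 : a = 0 := congrFun h 0
    have h1 : 1 + m * a = 0 := congrFun h 1
    simp [h0] at h1)

/-- The `d`-th power of the linear form with coefficient vector `(a, 1 + m a)`. -/
noncomputable def chartPower {K : Type} [Field K] (d : ℕ) (m a : K) :
    MvPolynomial (Fin (1 + 1)) K :=
  (X 1 + C a * (X 0 + C m * X 1)) ^ d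

theorem affineChart_injective {K : Type} [Field K] (m : K) :
    Function.Injective (affineChart m) := by
  intro a b h
  obtain ⟨u, hu⟩ := (Projectivization.mk_eq_mk_iff' K _ _ _ _).1 h
  have h0 : u * b = a := congrFun hu 0
  have h1 : u * (1 + m * b) = 1 + m * a := congrFun hu 1
  have : u = 1 := by linear_combination h1 - m * h0
  rw [← h0, this, one_mul]

theorem exists_powForm_affineChart {K : Type} [Field K] (d : ℕ) (m a : K) :
    ∃ u : K, u ≠ 0 ∧ powForm K 1 d (affineChart m a) = u • chartPower d m a := by
  have hne := (affineChart m a).rep_nonzero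
  obtain ⟨u, hu⟩ := (Projectivization.mk_eq_mk_iff' K _ _ hne _).1
    ((affineChart m a).mk_rep.trans rfl : _ = affineChart m a)
  have hu0 : u ≠ 0 := by
    rintro rfl
    exact hne (by rw [← hu, zero_smul])
  refine ⟨u ^ d, pow_ne_zero _ hu0, ?_⟩
  have h0 : (affineChart m a).rep 0 = u * a := (congrFun hu 0).symm
  have h1 : (affineChart m a).rep 1 = u * (1 + m * a) := (congrFun hu 1).symm
  have hsum : (∑ i, C ((affineChart m a).rep i) * X i : MvPolynomial (Fin (1 + 1)) K) =
      C u * (X 1 + C a * (X 0 + C m * X 1)) := by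
    rw [Fin.sum_univ_two, h0, h1]
    simp only [C_mul, C_add, C_1]
    ring
  rw [powForm, hsum, mul_pow, chartPower, smul_eq_C_mul, C_pow]

theorem decompSpan_image_affineChart {K : Type} [Field K] (d : ℕ) (m : K) (S : Set K) :
    decompSpan K 1 d (affineChart m '' S) = Submodule.span K (chartPower d m '' S) := by
  apply le_antisymm
  · rw [decompSpan, Submodule.span_le]
    rintro _ ⟨_, ⟨a, ha, rfl⟩, rfl⟩
    obtain ⟨u, -, h⟩ := exists_powForm_affineChart d m a
    rw [h]
    exact Submodule.smul_mem _ _ (Submodule.subset_span ⟨a, ha, rfl⟩)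
  · rw [Submodule.span_le]
    rintro _ ⟨a, ha, rfl⟩
    obtain ⟨u, hu, h⟩ := exists_powForm_affineChart d m a
    rw [← inv_smul_smul₀ hu (chartPower d m a), ← h]
    exact Submodule.smul_mem _ _ (Submodule.subset_span ⟨_, ⟨a, ha, rfl⟩, rfl⟩)

theorem exists_affineChart_eq {K : Type} [Field K] (m : K)
    (p : Projectivization K (Fin (1 + 1) → K)) (hm : m ≠ p.rep 1 / p.rep 0) :
    ∃ a, affineChart m a = p := by
  have hne : p.rep 1 - m * p.rep 0 ≠ 0 := by
    intro h
    by_cases h0 : p.rep 0 = 0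
    · apply p.rep_nonzero
      funext i
      fin_cases i
      · exact h0
      · simpa [h0] using h
    · apply hm
      rw [eq_div_iff h0]
      linear_combination -h
  refine ⟨p.rep 0 / (p.rep 1 - m * p.rep 0), ?_⟩
  conv_rhs => rw [← p.mk_rep]
  refine (Projectivization.mk_eq_mk_iff' K _ _ _ _).2 ⟨(p.rep 1 - m * p.rep 0)⁻¹, ?_⟩
  funext i
  fin_cases i
  · simp [div_eq_inv_mul]
  · simp only [Fin.mk_one, Pi.smul_apply, smul_eq_mul, Matrix.cons_val_one, Matrix.cons_val_fin_one]
    field_simp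
    ring

theorem exists_image_affineChart_eq {K : Type} [Field K] [DecidableEq K]
    [DecidableEq (Projectivization K (Fin (1 + 1) → K))] (m : K)
    (A : Finset (Projectivization K (Fin (1 + 1) → K)))
    (hm : ∀ p ∈ A, m ≠ p.rep 1 / p.rep 0) :
    ∃ A' : Finset K, A'.image (affineChart m) = A := by
  choose! g hg using fun p hp => exists_affineChart_eq m p (hm p hp)
  refine ⟨A.image g, ?_⟩
  rw [Finset.image_image]
  exact (Finset.image_congr fun p hp => hg p hp).trans Finset.image_id

/-- A linear functional is polynomial of degree at most `d` along `chartPower d m`. -/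
theorem exists_polynomial_of_functional {K : Type} [Field K] (d : ℕ) (m : K)
    (ψ : MvPolynomial (Fin (1 + 1)) K →ₗ[K] K) :
    ∃ R : Polynomial K, R.natDegree ≤ d ∧ ∀ a, ψ (chartPower d m a) = R.eval a := by
  refine ⟨∑ k ∈ Finset.range (d + 1), Polynomial.C
    (ψ ((X 0 + C m * X 1) ^ k * X 1 ^ (d - k) * (d.choose k : MvPolynomial (Fin (1 + 1)) K)))
      * Polynomial.X ^ k, ?_, fun a => ?_⟩
  · refine Polynomial.natDegree_sum_le_of_forall_le _ _ fun k hk => ?_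
    exact (Polynomial.natDegree_C_mul_X_pow_le _ _).trans
      (Nat.lt_succ_iff.1 (Finset.mem_range.1 hk))
  · rw [chartPower, add_comm (X 1), add_pow, map_sum, Polynomial.eval_finsetSum]
    refine Finset.sum_congr rfl fun k _ => ?_
    rw [mul_pow, ← C_pow, mul_assoc, mul_assoc, ← smul_eq_C_mul, map_smul, smul_eq_mul,
      Polynomial.eval_mul, Polynomial.eval_C, Polynomial.eval_pow, Polynomial.eval_X, mul_comm,
      mul_assoc]

/-- Every polynomial of degree at most `d` arises from a linear functional along
`chartPower d m`. -/
theorem exists_functional_of_polynomial {K : Type} [Field K] [CharZero K] (d : ℕ) (m : K)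
    (R : Polynomial K) (hR : R.natDegree ≤ d) :
    ∃ ψ : MvPolynomial (Fin (1 + 1)) K →ₗ[K] K, ∀ a, ψ (chartPower d m a) = R.eval a := by
  let φ : MvPolynomial (Fin (1 + 1)) K →ₐ[K] Polynomial K :=
    aeval ![Polynomial.X - Polynomial.C m, 1]
  have hφ (a : K) : φ (chartPower d m a) = (1 + Polynomial.C a * Polynomial.X) ^ d := by
    simp [φ, chartPower, ← algebraMap_eq, Polynomial.algebraMap_eq]
  have hcoeff (a : K) (k : ℕ) :
      (φ (chartPower d m a)).coeff k = d.choose k * a ^ k := by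
    have : (1 + Polynomial.C a * Polynomial.X : Polynomial K) ^ d =
        ((1 + Polynomial.X : Polynomial K) ^ d).comp (Polynomial.C a * Polynomial.X) := by simp
    rw [hφ, this, Polynomial.comp_C_mul_X_coeff, Polynomial.coeff_one_add_X_pow]
  refine ⟨∑ k ∈ Finset.range (d + 1),
    (R.coeff k / d.choose k) • (Polynomial.lcoeff K k ∘ₗ φ.toLinearMap), fun a => ?_⟩
  rw [Polynomial.eval_eq_sum_range' (Nat.lt_succ_of_le hR)]
  simp only [LinearMap.sum_apply, LinearMap.smul_apply, LinearMap.comp_apply,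
    AlgHom.toLinearMap_apply, Polynomial.lcoeff_apply, hcoeff, smul_eq_mul]
  refine Finset.sum_congr rfl fun k hk => ?_
  have : (d.choose k : K) ≠ 0 := by
    exact_mod_cast (Nat.choose_pos (Nat.lt_succ_iff.1 (Finset.mem_range.1 hk))).ne'
  field_simp

/-- All but finitely many members of a pencil spanned by two distinct separable monic
polynomials of the same degree are separable. -/
theorem finite_setOf_not_separable_pencil {K : Type} [Field K] [IsAlgClosed K]
    {p q : Polynomial K} (hp : p.Monic) (hq : q.Monic) (hps : p.Separable)
    (hqs : q.Separable) (hdeg : p.natDegree = q.natDegree) (hpq : p ≠ q) :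
    {t : K | ¬ (p + Polynomial.C t * q).Separable}.Finite := by
  classical
  have hW : p * q.derivative - p.derivative * q ≠ 0 := by
    intro h
    have hdvd : p ∣ p.derivative * q := ⟨q.derivative, (sub_eq_zero.1 h).symm⟩
    have hdvd' : p ∣ q := IsCoprime.dvd_of_dvd_mul_left hps hdvd
    exact hpq (Polynomial.eq_of_monic_of_dvd_of_natDegree_le hp hq hdvd' hdeg.ge).symm
  refine ((p * q.derivative - p.derivative * q).roots.toFinset.image fun z =>
    if q.eval z = 0 then -(p.derivative.eval z / q.derivative.eval z)
      else -(p.eval z / q.eval z)).finite_toSet.subset ?_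
  intro t ht
  obtain ⟨z, hz, hz'⟩ : ∃ z, (p + Polynomial.C t * q).eval z = 0 ∧
      (p + Polynomial.C t * q).derivative.eval z = 0 := by
    by_contra! hcon
    refine ht ((Polynomial.isCoprime_iff_aeval_ne_zero_of_isAlgClosed K K _ _).2 fun z => ?_)
    simpa only [Polynomial.coe_aeval_eq_eval] using or_iff_not_imp_left.2
      fun h => hcon z (not_not.1 h)
  simp only [Polynomial.eval_add, Polynomial.eval_mul, Polynomial.eval_C, Polynomial.derivative_add,
    Polynomial.derivative_C_mul] at hz hz'
  rw [Finset.mem_coe, Finset.mem_image]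
  refine ⟨z, ?_, ?_⟩
  · rw [Multiset.mem_toFinset, Polynomial.mem_roots hW, Polynomial.IsRoot.def]
    simp only [Polynomial.eval_sub, Polynomial.eval_mul]
    linear_combination q.derivative.eval z * hz - q.eval z * hz'
  · split_ifs with h
    · have hne : q.derivative.eval z ≠ 0 := by
        intro h'
        obtain ⟨u, v, huv⟩ := hqs
        simpa [h, h'] using congrArg (Polynomial.eval z) huv
      rw [neg_eq_iff_eq_neg, div_eq_iff hne]
      linear_combination hz'
    · rw [neg_eq_iff_eq_neg, div_eq_iff h]
      linear_combination hz

/-- If `f` lies in the spans of `chartPower d m` over the root sets of `p` and `q`, it lies in the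
span over the root set of every separable member of the pencil with full degree. -/
theorem mem_span_chartPower_pencil {K : Type} [Field K] [CharZero K] [IsAlgClosed K] {d : ℕ}
    {m t : K} {f : MvPolynomial (Fin (1 + 1)) K} {p q h : Polynomial K}
    (hh : h = p + Polynomial.C t * q) (hsep : h.Separable)
    (hp : p.natDegree ≤ h.natDegree) (hq : q.natDegree ≤ h.natDegree)
    {A B C : Set K} (hA : ∀ a ∈ A, p.eval a = 0) (hB : ∀ a ∈ B, q.eval a = 0)
    (hC : ∀ a, h.eval a = 0 → a ∈ C)
    (hfA : f ∈ Submodule.span K (chartPower d m '' A))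
    (hfB : f ∈ Submodule.span K (chartPower d m '' B)) :
    f ∈ Submodule.span K (chartPower d m '' C) := by
  by_contra hf
  obtain ⟨ψ, hψf, hψ⟩ := Submodule.exists_le_ker_of_notMem hf
  obtain ⟨R, hRd, hR⟩ := exists_polynomial_of_functional d m ψ
  have hdvd : h ∣ R := by
    have hroots := IsAlgClosed.splits h
    by_cases hR0 : R = 0
    · simp [hR0]
    refine (hroots.dvd_iff_roots_le_roots hsep.ne_zero hR0).2 ?_
    refine (Multiset.le_iff_subset (Polynomial.nodup_roots hsep)).2 fun a ha => ?_
    rw [Polynomial.mem_roots hR0, Polynomial.IsRoot.def, ← hR]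
    exact hψ (Submodule.subset_span ⟨a, hC a (Polynomial.isRoot_of_mem_roots ha), rfl⟩)
  obtain ⟨Q, rfl⟩ := hdvd
  have key (g : Polynomial K) (hg : g.natDegree ≤ h.natDegree) : (g * Q).natDegree ≤ d := by
    by_cases hQ : Q = 0
    · simp [hQ]
    rw [Polynomial.natDegree_mul hsep.ne_zero hQ] at hRd
    exact Polynomial.natDegree_mul_le.trans ((Nat.add_le_add_right hg _).trans hRd)
  obtain ⟨α, hα⟩ := exists_functional_of_polynomial d m (p * Q) (key p hp)
  obtain ⟨β, hβ⟩ := exists_functional_of_polynomial d m (q * Q) (key q hq)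
  have hαf : α f = 0 := by
    have : Submodule.span K (chartPower d m '' A) ≤ LinearMap.ker α := by
      rw [Submodule.span_le]
      rintro _ ⟨a, ha, rfl⟩
      simp [hα, hA a ha]
    exact this hfA
  have hβf : β f = 0 := by
    have : Submodule.span K (chartPower d m '' B) ≤ LinearMap.ker β := by
      rw [Submodule.span_le]
      rintro _ ⟨a, ha, rfl⟩
      simp [hβ, hB a ha]
    exact this hfB
  have hψ' : Submodule.span K (chartPower d m '' A) ≤ LinearMap.ker (ψ - (α + t • β)) := by
    rw [Submodule.span_le]
    rintro _ ⟨a, -, rfl⟩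
    simp [hα, hβ, hR, hh]
    ring
  have := hψ' hfA
  apply hψf
  simpa [hαf, hβf] using this

/-- If `f` is a combination of the powers `chartPower d m` over two distinct finite sets of the same
cardinality, then it is so over infinitely many such sets. -/
theorem infinite_setOf_mem_span_chartPower {K : Type} [Field K] [CharZero K] [IsAlgClosed K]
    {d : ℕ} {m : K} {f : MvPolynomial (Fin (1 + 1)) K} {A B : Finset K} (hAB : A ≠ B)
    (hcard : A.card = B.card)
    (hfA : f ∈ Submodule.span K (chartPower d m '' A))
    (hfB : f ∈ Submodule.span K (chartPower d m '' B)) :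
    {C : Finset K | f ∈ Submodule.span K (chartPower d m '' C) ∧ C.card = A.card}.Infinite := by
  classical
  let P (S : Finset K) : Polynomial K := ∏ a ∈ S, (Polynomial.X - Polynomial.C a)
  have hmonic (S : Finset K) : (P S).Monic := Polynomial.monic_prod_X_sub_C _ _
  have hsepP (S : Finset K) : (P S).Separable :=
    Polynomial.separable_prod_X_sub_C_iff'.2 fun x _ y _ h => h
  have hdeg (S : Finset K) : (P S).natDegree = S.card := by
    simp [P]
  have hrootsP (S : Finset K) : (P S).roots = S.val := Polynomial.roots_prod_X_sub_C S
  have hPAB : P A ≠ P B := fun h => hAB (Finset.val_injective (by rw [← hrootsP, h, hrootsP]))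
  have hdegAB : (P A).natDegree = (P B).natDegree := by rw [hdeg, hdeg, hcard]
  have hbad := (finite_setOf_not_separable_pencil (hmonic A) (hmonic B) (hsepP A) (hsepP B)
    hdegAB hPAB).union (Set.finite_singleton (-1))
  let H (t : K) : Polynomial K := P A + Polynomial.C t * P B
  have hHcoeff (t : K) : (H t).coeff A.card = 1 + t := by
    have h1 : (P A).coeff A.card = 1 := by rw [← hdeg A]; exact hmonic A
    have h2 : (P B).coeff A.card = 1 := by rw [hcard, ← hdeg B]; exact hmonic B
    simp [H, h1, h2]
  have hHdeg (t : K) (ht : t ≠ -1) : (H t).natDegree = A.card := by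
    apply Polynomial.natDegree_eq_of_le_of_coeff_ne_zero
    · refine (Polynomial.natDegree_add_le _ _).trans (max_le (hdeg A).le ?_)
      exact (Polynomial.natDegree_C_mul_le _ _).trans ((hdeg B).trans hcard.symm).le
    · rw [hHcoeff]
      exact fun h => ht (by linear_combination h)
  refine Set.infinite_of_injOn_mapsTo (f := fun t => (H t).roots.toFinset) ?_ ?_
    hbad.infinite_compl
  · intro t ht u hu htu
    simp only [Set.mem_compl_iff, Set.mem_union, Set.mem_ofPred_eq, Set.mem_singleton_iff, not_or,
      not_not] at ht hu
    have hroots : (H t).roots = (H u).roots := by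
      have := congrArg Finset.val htu
      rwa [Multiset.toFinset_val, Multiset.toFinset_val, (Polynomial.nodup_roots ht.1).dedup,
        (Polynomial.nodup_roots hu.1).dedup] at this
    have hlead (s : K) (hs : s ≠ -1) : (H s).leadingCoeff = 1 + s := by
      rw [Polynomial.leadingCoeff, hHdeg s hs, hHcoeff]
    have h1 := (IsAlgClosed.splits (H t)).eq_prod_roots
    have h2 := (IsAlgClosed.splits (H u)).eq_prod_roots
    rw [hlead t ht.2] at h1
    rw [hlead u hu.2, ← hroots] at h2
    have h3 : Polynomial.C (1 + u) * H t = Polynomial.C (1 + t) * H u := by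
      rw [h1, h2]
      ring
    have h4 : Polynomial.C (u - t) * (P A - P B) = 0 := by
      simp only [H, map_add, map_sub, map_one] at h3 ⊢
      linear_combination h3
    rcases mul_eq_zero.1 h4 with h | h
    · exact (sub_eq_zero.1 (Polynomial.C_eq_zero.1 h)).symm
    · exact absurd (sub_eq_zero.1 h) hPAB
  · intro t ht
    simp only [Set.mem_compl_iff, Set.mem_union, Set.mem_ofPred_eq, Set.mem_singleton_iff, not_or,
      not_not] at ht
    have hroot (S : Finset K) (a : K) (ha : a ∈ (S : Set K)) : (P S).eval a = 0 :=
      Polynomial.isRoot_of_mem_roots (by rwa [hrootsP])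
    refine ⟨mem_span_chartPower_pencil (p := P A) (q := P B) (h := H t) rfl ht.1 ?_ ?_ (hroot A)
      (hroot B) ?_ hfA hfB, ?_⟩
    · rw [hHdeg t ht.2, hdeg]
    · rw [hHdeg t ht.2, hdeg, hcard]
    · intro a ha
      rw [Finset.mem_coe, Multiset.mem_toFinset]
      exact (Polynomial.mem_roots ht.1.ne_zero).2 ha
    · rw [Multiset.toFinset_card_of_nodup (Polynomial.nodup_roots ht.1),
        ← (IsAlgClosed.splits (H t)).natDegree_eq_card_roots, hHdeg t ht.2]

/-- Lemma 3.4: a nonzero binary form with two distinct decompositions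
has infinitely many decompositions. -/
theorem stmt_5 {K : Type} [Field K] [IsAlgClosed K] [CharZero K]
    {d : ℕ} (hd : 1 ≤ d)
    {f : MvPolynomial (Fin (1 + 1)) K} (hf0 : f ≠ 0) (hfh : f.IsHomogeneous d)
    {A B : Finset (Projectivization K (Fin (1 + 1) → K))}
    (hA : A ∈ decompSet K 1 d f) (hB : B ∈ decompSet K 1 d f) (hAB : A ≠ B) :
    (decompSet K 1 d f).Infinite := by
  classical
  obtain ⟨m, hm⟩ := ((A ∪ B).image fun p => p.rep 1 / p.rep 0).exists_notMem
  have hm' (p) (hp : p ∈ A ∪ B) : m ≠ p.rep 1 / p.rep 0 := by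
    rintro rfl
    exact hm (Finset.mem_image_of_mem _ hp)
  obtain ⟨A, rfl⟩ := exists_image_affineChart_eq m A fun p hp =>
    hm' p (Finset.mem_union_left _ hp)
  obtain ⟨B, rfl⟩ := exists_image_affineChart_eq m B fun p hp =>
    hm' p (Finset.mem_union_right _ hp)
  have hinj := affineChart_injective m
  have hmem (C : Finset K) : C.image (affineChart m) ∈ decompSet K 1 d f ↔
      f ∈ Submodule.span K (chartPower d m '' C) ∧ C.card = symRank K 1 d f := by
    rw [decompSet, Set.mem_ofPred_eq, Finset.coe_image, decompSpan_image_affineChart,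
      Finset.card_image_of_injective _ hinj]
  rw [hmem] at hA hB
  have hne : A ≠ B := fun h => hAB (by rw [h])
  refine Set.infinite_of_injOn_mapsTo (f := Finset.image (affineChart m))
    (Finset.image_injective hinj).injOn ?_
    (infinite_setOf_mem_span_chartPower hne (hA.2.trans hB.2.symm) hA.1 hB.1)
  intro C hC
  exact (hmem C).2 ⟨hC.1, hC.2.trans hA.2⟩
end

section
/- Let r = 1 and let f be a nonzero binary form of degree d over K. If A and B are two non-identified decompositions of f (i.e., two distinct subsets of ℙ^1 computing sr(f)), then the set A ∪ B of points of ℙ^1 has cardinality at least d + 2; in particular 2·sr(f) ≥ d + 2. -/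
open MvPolynomial

namespace BinaryForm

variable {K : Type} [Field K]

/-- The determinant of the representatives of two points of `ℙ^1` vanishes only when the points
agree. -/
theorem eq_of_det_rep_eq_zero {p q : Projectivization K (Fin (1 + 1) → K)}
    (h : q.rep 1 * p.rep 0 - q.rep 0 * p.rep 1 = 0) : p = q := by
  rw [← p.mk_rep, ← q.mk_rep, Projectivization.mk_eq_mk_iff']
  by_cases h0 : q.rep 0 = 0
  · have h1 : q.rep 1 ≠ 0 := fun h1 => q.rep_nonzero (by
      ext i; fin_cases i <;> simpa)
    refine ⟨p.rep 1 / q.rep 1, ?_⟩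
    ext i
    fin_cases i
    · simp_all
    · simp [h1]
  · refine ⟨p.rep 0 / q.rep 0, ?_⟩
    ext i
    fin_cases i
    · simp [h0]
    · simp only [Fin.mk_one, Pi.smul_apply, smul_eq_mul]
      field_simp
      linear_combination h

theorem powForm_ne_zero (d : ℕ) (p : Projectivization K (Fin (1 + 1) → K)) :
    powForm K 1 d p ≠ 0 := by
  refine pow_ne_zero d fun h => p.rep_nonzero ?_
  ext i
  have := congrArg (eval (Pi.single i (1 : K))) h
  fin_cases i <;> simpa [Fin.sum_univ_succ] using this

/-- The derivation killing the linear form attached to `q`. -/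
noncomputable def polarDerivation (q : Projectivization K (Fin (1 + 1) → K)) :
    Derivation K (MvPolynomial (Fin (1 + 1)) K) (MvPolynomial (Fin (1 + 1)) K) :=
  q.rep 1 • pderiv 0 - q.rep 0 • pderiv 1

theorem polarDerivation_powForm_succ (d : ℕ) (p q : Projectivization K (Fin (1 + 1) → K)) :
    polarDerivation q (powForm K 1 (d + 1) p) =
      ((d + 1 : K) * (q.rep 1 * p.rep 0 - q.rep 0 * p.rep 1)) • powForm K 1 d p := by
  have h01 : pderiv (0 : Fin (1 + 1)) (X 1 : MvPolynomial (Fin (1 + 1)) K) = 0 :=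
    pderiv_X_of_ne (by decide)
  have h10 : pderiv (1 : Fin (1 + 1)) (X 0 : MvPolynomial (Fin (1 + 1)) K) = 0 :=
    pderiv_X_of_ne (by decide)
  have hsum : ∑ i, C (p.rep i) * X i =
      (C (p.rep 0) * X 0 + C (p.rep 1) * X 1 : MvPolynomial (Fin (1 + 1)) K) :=
    Fin.sum_univ_two _
  simp only [polarDerivation, powForm, Derivation.leibniz_pow, Derivation.sub_apply,
    Derivation.smul_apply, hsum, map_add, pderiv_C_mul, pderiv_X_self, h01, h10,
    smul_eq_C_mul, smul_eq_mul, nsmul_eq_mul, map_mul, map_sub, map_natCast, map_one,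
    Nat.add_sub_cancel]
  push_cast
  ring

theorem linearIndepOn_powForm [CharZero K] (d : ℕ)
    (S : Finset (Projectivization K (Fin (1 + 1) → K))) (hS : S.card ≤ d + 1) :
    LinearIndepOn K (powForm K 1 d) (S : Set (Projectivization K (Fin (1 + 1) → K))) := by
  classical
  rw [linearIndepOn_finset_iff]
  induction S using Finset.induction_on generalizing d with
  | empty => simp
  | insert q S hq ih =>
    intro c hc
    rw [Finset.card_insert_of_notMem hq] at hS
    rw [Finset.sum_insert hq] at hc
    have hS0 : ∀ p ∈ S, c p = 0 := by
      rcases d with _ | d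
      · have : S = ∅ := Finset.card_eq_zero.1 (by omega)
        simp [this]
      · have hD := congrArg (polarDerivation q) hc
        simp only [map_add, map_sum, Derivation.map_smul, polarDerivation_powForm_succ, map_zero,
          smul_smul] at hD
        rw [mul_comm (q.rep 1), sub_self, mul_zero, mul_zero, zero_smul, zero_add] at hD
        intro p hp
        have hcp := ih d (by omega) _ hD p hp
        have hdet : q.rep 1 * p.rep 0 - q.rep 0 * p.rep 1 ≠ 0 := fun h =>
          hq (eq_of_det_rep_eq_zero h ▸ hp)
        have hd : (d + 1 : K) ≠ 0 := by exact_mod_cast d.succ_ne_zero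
        exact (mul_eq_zero.1 hcp).resolve_right (mul_ne_zero hd hdet)
    rw [Finset.sum_eq_zero fun p hp => by rw [hS0 p hp, zero_smul], add_zero] at hc
    intro p hp
    rcases Finset.mem_insert.1 hp with rfl | hp
    · exact (smul_eq_zero.1 hc).resolve_right (powForm_ne_zero d p)
    · exact hS0 p hp

end BinaryForm

/-- If a family is linearly independent on `s ∪ t`, an element of both spans lies in the span
over `s ∩ t`. -/
theorem LinearIndepOn.mem_span_image_inter {ι R M : Type*} [Semiring R] [AddCommMonoid M]
    [Module R M] {v : ι → M} {s t : Set ι} (hv : LinearIndepOn R v (s ∪ t)) {x : M}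
    (hs : x ∈ Submodule.span R (v '' s)) (ht : x ∈ Submodule.span R (v '' t)) :
    x ∈ Submodule.span R (v '' (s ∩ t)) := by
  rw [Finsupp.mem_span_image_iff_linearCombination R] at hs ht ⊢
  obtain ⟨a, has, rfl⟩ := hs
  obtain ⟨b, hbt, hab⟩ := ht
  rw [linearIndepOn_iffₛ] at hv
  obtain rfl : b = a := hv b
    (Finsupp.supported_mono Set.subset_union_right hbt) a
    (Finsupp.supported_mono Set.subset_union_left has) hab
  exact ⟨b, Set.subset_inter has hbt, rfl⟩

/-- for a nonzero binary form `f` with two distinct decompositions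
`A ≠ B`, the set `A ∪ B` of points of `ℙ^1` has cardinality at least `d + 2`; in
particular `2 · sr(f) ≥ d + 2`. -/
theorem stmt_6 {K : Type} [Field K] [IsAlgClosed K] [CharZero K]
    {d : ℕ} (hd : 1 ≤ d)
    {f : MvPolynomial (Fin (1 + 1)) K} (hf0 : f ≠ 0) (hfh : f.IsHomogeneous d)
    {A B : Finset (Projectivization K (Fin (1 + 1) → K))}
    (hA : A ∈ decompSet K 1 d f) (hB : B ∈ decompSet K 1 d f) (hAB : A ≠ B) :
    d + 2 ≤ ((↑A ∪ ↑B : Set (Projectivization K (Fin (1 + 1) → K)))).ncard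
    ∧ d + 2 ≤ 2 * symRank K 1 d f := by
  classical
  have hcard : d + 2 ≤ (A ∪ B).card := by
    by_contra! hlt
    have hli := BinaryForm.linearIndepOn_powForm (K := K) d (A ∪ B) (by omega)
    rw [Finset.coe_union] at hli
    have hmem := hli.mem_span_image_inter hA.1 hB.1
    rw [← Finset.coe_inter] at hmem
    have hle : A.card ≤ (A ∩ B).card := hA.2.trans_le (Nat.sInf_le ⟨A ∩ B, rfl, hmem⟩)
    have hsub : A ⊆ B :=
      Finset.inter_eq_left.1 (Finset.eq_of_subset_of_card_le Finset.inter_subset_left hle)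
    exact hAB (Finset.eq_of_subset_of_card_le hsub (hB.2.trans hA.2.symm).le)
  refine ⟨by rwa [← Finset.coe_union, Set.ncard_coe_finset], ?_⟩
  have hunion := Finset.card_union_le A B
  rw [hA.2, hB.2] at hunion
  omega
end

section
/- Let f be a nonzero homogeneous polynomial of degree d in x_0,…,x_r over K, let A ∈ S(f) be a decomposition of f, and let G be a nonempty proper subset of A. Then the subspace span{ℓ^d : ℓ ∈ G} ∩ span({f} ∪ {ℓ^d : ℓ ∈ A ∖ G}) of the space of degree-d forms is exactly one-dimensional. -/
open MvPolynomial

/-- Intersecting a submodule with the span of a disjoint submodule and one extra vector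
leaves the line spanned by the component of that vector. -/
theorem inf_span_singleton_sup_of_disjoint {R M : Type*} [Ring R] [AddCommGroup M] [Module R M]
    {P Q : Submodule R M} (hPQ : Disjoint P Q) {g h : M} (hg : g ∈ P) (hh : h ∈ Q) :
    P ⊓ (Submodule.span R {g + h} ⊔ Q) = Submodule.span R {g} := by
  apply le_antisymm
  · rintro x ⟨hxP, hx⟩
    obtain ⟨_, hu, y, hy, rfl⟩ := Submodule.mem_sup.1 hx
    obtain ⟨c, rfl⟩ := Submodule.mem_span_singleton.1 hu
    have hQ : c • h + y ∈ Q := Q.add_mem (Q.smul_mem c hh) hy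
    have hP : c • h + y ∈ P := by
      have := P.sub_mem hxP (P.smul_mem c hg)
      rwa [smul_add, add_assoc, add_sub_cancel_left] at this
    have h0 := Submodule.disjoint_def.1 hPQ _ hP hQ
    rw [smul_add, add_assoc, h0, add_zero]
    exact Submodule.smul_mem _ _ (Submodule.mem_span_singleton_self g)
  · rw [Submodule.span_singleton_le_iff_mem]
    refine ⟨hg, ?_⟩
    simpa using sub_mem
      (Submodule.mem_sup_left (T := Q) (Submodule.mem_span_singleton_self (R := R) (g + h)))
      (Submodule.mem_sup_right hh)

theorem symRank_le_card {K : Type} [Field K] {r d : ℕ} {f : MvPolynomial (Fin (r + 1)) K}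
    {B : Finset (Projectivization K (Fin (r + 1) → K))} (hB : f ∈ decompSpan K r d ↑B) :
    symRank K r d f ≤ B.card :=
  Nat.sInf_le ⟨B, rfl, hB⟩

theorem notMem_decompSpan_of_ssubset {K : Type} [Field K] {r d : ℕ}
    {f : MvPolynomial (Fin (r + 1)) K} {A B : Finset (Projectivization K (Fin (r + 1) → K))}
    (hA : A ∈ decompSet K r d f) (hBA : B ⊂ A) : f ∉ decompSpan K r d ↑B := fun hB =>
  (Finset.card_lt_card hBA).not_ge (hA.2.trans_le (symRank_le_card hB))

theorem linearIndepOn_powForm_of_mem_decompSet {K : Type} [Field K] {r d : ℕ}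
    {f : MvPolynomial (Fin (r + 1)) K} {A : Finset (Projectivization K (Fin (r + 1) → K))}
    (hA : A ∈ decompSet K r d f) : LinearIndepOn K (powForm K r d) (A : Set _) := by
  classical
  rw [linearIndepOn_iff_notMem_span]
  intro a ha hmem
  refine notMem_decompSpan_of_ssubset hA (Finset.erase_ssubset (Finset.mem_coe.1 ha)) ?_
  rw [decompSpan, Finset.coe_erase, ← Submodule.span_insert_eq_span hmem, ← Set.image_insert_eq,
    Set.insert_sdiff_singleton, Set.insert_eq_of_mem ha]
  exact hA.1

/-- if `A` is a decomposition of `f` and `G` is a nonempty proper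
subset of `A`, then `span{ℓ^d : ℓ ∈ G} ∩ span({f} ∪ {ℓ^d : ℓ ∈ A \ G})` is
one-dimensional. -/
theorem stmt_8 {K : Type} [Field K] [IsAlgClosed K] [CharZero K]
    {r d : ℕ} (hr : 1 ≤ r) (hd : 1 ≤ d)
    {f : MvPolynomial (Fin (r + 1)) K} (hf0 : f ≠ 0) (hfh : f.IsHomogeneous d)
    {A G : Finset (Projectivization K (Fin (r + 1) → K))}
    (hA : A ∈ decompSet K r d f) (hGA : G ⊆ A) (hGne : G.Nonempty) (hGpr : G ≠ A) :
    Module.finrank K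
      ↥(decompSpan K r d ↑G ⊓
        Submodule.span K
          ({f} ∪ powForm K r d ''
            ((↑A : Set (Projectivization K (Fin (r + 1) → K))) \ ↑G))) = 1 := by
  classical
  have hunion : (↑G ∪ (↑A \ ↑G) : Set (Projectivization K (Fin (r + 1) → K))) = ↑A :=
    Set.union_sdiff_cancel (Finset.coe_subset.2 hGA)
  have hdisj : Disjoint (decompSpan K r d ↑G) (decompSpan K r d (↑A \ ↑G)) := by
    have hli := linearIndepOn_powForm_of_mem_decompSet hA
    rw [← hunion, linearIndepOn_union_iff Set.disjoint_sdiff_right] at hli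
    exact hli.2.2
  have hfA := hA.1
  rw [decompSpan, ← hunion, Set.image_union, Submodule.span_union] at hfA
  obtain ⟨g, hg, h, hh, rfl⟩ := Submodule.mem_sup.1 hfA
  have hg0 : g ≠ 0 := by
    rintro rfl
    refine notMem_decompSpan_of_ssubset hA (Finset.sdiff_ssubset hGA hGne) ?_
    rwa [zero_add, decompSpan, Finset.coe_sdiff]
  have hinf := inf_span_singleton_sup_of_disjoint hdisj hg hh
  rw [decompSpan.eq_1 K r d (↑A \ ↑G), ← Submodule.span_union] at hinf
  rw [hinf, finrank_span_singleton hg0]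
end

section
/- Let f be a nonzero homogeneous polynomial of degree d in x_0,…,x_r over K, let A ∈ S(f) and let G ⊆ A be nonempty, with F := A ∖ G. Let g be a nonzero homogeneous polynomial of degree d with g ∈ span{ℓ^d : ℓ ∈ G} and f ∈ span({g} ∪ {ℓ^d : ℓ ∈ F}). Let E be a finite set of pairwise non-proportional nonzero linear forms with g ∈ span{ℓ^d : ℓ ∈ E}, #E = sr(g), and such that no form of E is proportional to a form of F. Then E ∪ F is a decomposition of f, i.e., f ∈ span{ℓ^d : ℓ ∈ E ∪ F} and #E + #F = sr(f); moreover sr(f) = #F + sr(g) and sr(g) = #G. -/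
open MvPolynomial

/-- Claim 1: with `A ∈ S(f)`, `G ⊆ A` nonempty, `F := A \ G`, `g` a
nonzero form in `span{ℓ^d : ℓ ∈ G}` with `f ∈ span({g} ∪ {ℓ^d : ℓ ∈ F})`, and `E`
a decomposition of `g` disjoint from `F`, the set `E ∪ F` is a decomposition of
`f`; moreover `sr(f) = #F + sr(g)` and `sr(g) = #G`. -/
theorem stmt_9 {K : Type} [Field K] [IsAlgClosed K] [CharZero K]
    {r d : ℕ} (hr : 1 ≤ r) (hd : 1 ≤ d)
    {f : MvPolynomial (Fin (r + 1)) K} (hf0 : f ≠ 0) (hfh : f.IsHomogeneous d)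
    {A G : Finset (Projectivization K (Fin (r + 1) → K))}
    (hA : A ∈ decompSet K r d f) (hGA : G ⊆ A) (hGne : G.Nonempty)
    {g : MvPolynomial (Fin (r + 1)) K} (hg0 : g ≠ 0)
    (hgG : g ∈ decompSpan K r d ↑G)
    (hfg : f ∈ Submodule.span K
      ({g} ∪ powForm K r d ''
        ((↑A : Set (Projectivization K (Fin (r + 1) → K))) \ ↑G)))
    {E : Finset (Projectivization K (Fin (r + 1) → K))}
    (hgE : g ∈ decompSpan K r d ↑E) (hEcard : E.card = symRank K r d g)
    (hEF : ∀ p ∈ E, p ∉ (↑A : Set (Projectivization K (Fin (r + 1) → K))) \ ↑G) :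
    f ∈ decompSpan K r d
        ((↑E : Set (Projectivization K (Fin (r + 1) → K))) ∪ (↑A \ ↑G))
    ∧ E.card + ((↑A : Set (Projectivization K (Fin (r + 1) → K))) \ ↑G).ncard
        = symRank K r d f
    ∧ symRank K r d f
        = ((↑A : Set (Projectivization K (Fin (r + 1) → K))) \ ↑G).ncard
          + symRank K r d g
    ∧ symRank K r d g = G.card := by
  classical
  have hfEF : f ∈ decompSpan K r d
      ((↑E : Set (Projectivization K (Fin (r + 1) → K))) ∪ (↑A \ ↑G)) := by
    refine Submodule.span_le.2 (Set.union_subset ?_ ?_) hfg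
    · exact Set.singleton_subset_iff.2
        (Submodule.span_mono (Set.image_mono Set.subset_union_left) hgE)
    · exact (Set.image_mono Set.subset_union_right).trans Submodule.subset_span
  have hle : symRank K r d f ≤ (E ∪ (A \ G)).card :=
    Nat.sInf_le ⟨E ∪ (A \ G), rfl, by simpa using hfEF⟩
  have hgle : symRank K r d g ≤ G.card := Nat.sInf_le ⟨G, rfl, hgG⟩
  have hncard : ((↑A : Set (Projectivization K (Fin (r + 1) → K))) \ ↑G).ncard
      = (A \ G).card := by
    rw [← Finset.coe_sdiff, Set.ncard_coe_finset]
  have hunion := Finset.card_union_le E (A \ G)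
  have hsplit := Finset.card_sdiff_add_card_eq_card hGA
  have hAcard := hA.2
  refine ⟨hfEF, ?_, ?_, ?_⟩ <;> omega
end
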